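/- arXiv:1910.13424 — 2 statements merged into one kernel-verified Lean document; each statement's English description precedes it below -/
import Mathlib

section
/- Let 0 < m ≤ 1 and let F₀:[0,∞)→ℝ be Lipschitz continuous and sublinear with 0 ≤ F₀(x) ≤ m·x for all x ≥ 0. Then there exists exactly one function F:[0,∞)×[0,∞)→ℝ such that: F is Lipschitz continuous on [0,∞)×[0,∞); F is sublinear in x; 0 ≤ F(x,t) ≤ m·x for all x,t ≥ 0; F(x,0) = F₀(x) for all x ≥ 0; and F is a viscosity solution of (HJ) on (0,∞)×(0,∞). -/
open Set Filter

/-- A function `ψ : [0,∞) → ℝ` is sublinear if `ψ(x)/x → 0` as `x → ∞`. -/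
def Sublinear (ψ : ℝ → ℝ) : Prop :=
  Tendsto (fun x => ψ x / x) atTop (nhds 0)

/-- `F` is sublinear in `x` if `x ↦ F(x,t)` is sublinear for each `t ≥ 0`. -/
def SublinearInX (F : ℝ → ℝ → ℝ) : Prop :=
  ∀ t, 0 ≤ t → Sublinear (fun x => F x t)

/-- Viscosity subsolution of
`∂ₜF + (1/2)(∂ₓF − m)(∂ₓF − m − 1) + F/x − m = 0` on `(0,∞) × (0,∞)`. -/
def IsSubsolutionHJ (m : ℝ) (F : ℝ → ℝ → ℝ) : Prop :=
  ∀ φ : ℝ × ℝ → ℝ, ContDiff ℝ 1 φ →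
    ∀ x₀ t₀ : ℝ, 0 < x₀ → 0 < t₀ →
      IsLocalMaxOn (fun p : ℝ × ℝ => F p.1 p.2 - φ p) (Ici 0 ×ˢ Ici 0) (x₀, t₀) →
      deriv (fun s => φ (x₀, s)) t₀ +
        (1 / 2) * (deriv (fun y => φ (y, t₀)) x₀ - m) *
          (deriv (fun y => φ (y, t₀)) x₀ - m - 1) +
        F x₀ t₀ / x₀ - m ≤ 0

/-- Viscosity supersolution of
`∂ₜF + (1/2)(∂ₓF − m)(∂ₓF − m − 1) + F/x − m = 0` on `(0,∞) × (0,∞)`. -/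
def IsSupersolutionHJ (m : ℝ) (F : ℝ → ℝ → ℝ) : Prop :=
  ∀ φ : ℝ × ℝ → ℝ, ContDiff ℝ 1 φ →
    ∀ x₀ t₀ : ℝ, 0 < x₀ → 0 < t₀ →
      IsLocalMinOn (fun p : ℝ × ℝ => F p.1 p.2 - φ p) (Ici 0 ×ˢ Ici 0) (x₀, t₀) →
      deriv (fun s => φ (x₀, s)) t₀ +
        (1 / 2) * (deriv (fun y => φ (y, t₀)) x₀ - m) *
          (deriv (fun y => φ (y, t₀)) x₀ - m - 1) +
        F x₀ t₀ / x₀ - m ≥ 0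

/-- Viscosity solution of (HJ). -/
def IsSolutionHJ (m : ℝ) (F : ℝ → ℝ → ℝ) : Prop :=
  IsSubsolutionHJ m F ∧ IsSupersolutionHJ m F

/-- A Lipschitz (on the quadrant), sublinear-in-`x` viscosity solution of (HJ)
with `0 ≤ F(x,t) ≤ m·x` and initial data `F₀`. -/
def GoodSolution (m : ℝ) (F₀ : ℝ → ℝ) (F : ℝ → ℝ → ℝ) : Prop :=
  (∃ K : NNReal, LipschitzOnWith K (fun p : ℝ × ℝ => F p.1 p.2) (Ici 0 ×ˢ Ici 0)) ∧
  SublinearInX F ∧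
  (∀ x t : ℝ, 0 ≤ x → 0 ≤ t → 0 ≤ F x t ∧ F x t ≤ m * x) ∧
  (∀ x : ℝ, 0 ≤ x → F x 0 = F₀ x) ∧
  IsSolutionHJ m F

open Topology

/-- `F` is `K`-Lipschitz on the quadrant for the `ℓ¹` distance. -/
def QuadrantLip (K : ℝ) (F : ℝ → ℝ → ℝ) : Prop :=
  ∀ x t y s : ℝ, 0 ≤ x → 0 ≤ t → 0 ≤ y → 0 ≤ s →
    |F x t - F y s| ≤ K * (|x - y| + |t - s|)

lemma QuadrantLip.mono {K L : ℝ} {F : ℝ → ℝ → ℝ} (hF : QuadrantLip K F) (hKL : K ≤ L) :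
    QuadrantLip L F := fun x t y s hx ht hy hs =>
  (hF x t y s hx ht hy hs).trans (mul_le_mul_of_nonneg_right hKL (by positivity))

lemma exists_quadrantLip {F : ℝ → ℝ → ℝ}
    (h : ∃ K : NNReal, LipschitzOnWith K (fun p : ℝ × ℝ => F p.1 p.2) (Ici 0 ×ˢ Ici 0)) :
    ∃ K : ℝ, 0 ≤ K ∧ QuadrantLip K F := by
  obtain ⟨K, hK⟩ := h
  refine ⟨K, K.2, fun x t y s hx ht hy hs => ?_⟩
  have h1 := hK.dist_le_mul (x, t) ⟨hx, ht⟩ (y, s) ⟨hy, hs⟩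
  rw [Real.dist_eq, Prod.dist_eq, Real.dist_eq, Real.dist_eq] at h1
  exact h1.trans (mul_le_mul_of_nonneg_left
    (max_le (le_add_of_nonneg_right (abs_nonneg _)) (le_add_of_nonneg_left (abs_nonneg _))) K.2)

lemma QuadrantLip.lipschitzOnWith {K : ℝ} {F : ℝ → ℝ → ℝ} (hK : 0 ≤ K) (h : QuadrantLip K F) :
    ∃ L : NNReal, LipschitzOnWith L (fun p : ℝ × ℝ => F p.1 p.2) (Ici 0 ×ˢ Ici 0) := by
  refine ⟨⟨2 * K, by positivity⟩, LipschitzOnWith.of_dist_le_mul fun p hp q hq => ?_⟩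
  have h1 := h p.1 p.2 q.1 q.2 hp.1 hp.2 hq.1 hq.2
  rw [Real.dist_eq, Prod.dist_eq, Real.dist_eq, Real.dist_eq]
  refine h1.trans ?_
  have h2 := le_max_left |p.1 - q.1| |p.2 - q.2|
  have h3 := le_max_right |p.1 - q.1| |p.2 - q.2|
  change _ ≤ 2 * K * _
  nlinarith

lemma QuadrantLip.continuousOn {K : ℝ} {F : ℝ → ℝ → ℝ} (hK : 0 ≤ K) (h : QuadrantLip K F) :
    ContinuousOn (fun p : ℝ × ℝ => F p.1 p.2) (Ici 0 ×ˢ Ici 0) :=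
  (h.lipschitzOnWith hK).choose_spec.continuousOn

/-- A sublinear function bounded by `m x` lies below a line of any prescribed positive slope. -/
lemma Sublinear.exists_le_add {ψ : ℝ → ℝ} (hψ : Sublinear ψ) {m : ℝ} (hm : 0 ≤ m)
    (hb : ∀ x, 0 ≤ x → ψ x ≤ m * x) {δ : ℝ} (hδ : 0 < δ) :
    ∃ A : ℝ, 0 ≤ A ∧ ∀ x, 0 ≤ x → ψ x ≤ δ * x + A := by
  have h1 : ∀ᶠ x in atTop, ψ x / x < δ := hψ.eventually_lt_const hδ
  obtain ⟨B, hB⟩ := eventually_atTop.1 h1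
  refine ⟨m * max B 1, by positivity, fun x hx => ?_⟩
  rcases le_total x (max B 1) with h | h
  · have := hb x hx
    nlinarith
  · have hx0 : 0 < x := lt_of_lt_of_le (by positivity) h
    have h2 := hB x ((le_max_left _ _).trans h)
    rw [div_lt_iff₀ hx0] at h2
    have : 0 ≤ m * max B 1 := by positivity
    linarith

/-- The doubled functional used in the comparison principle. -/
noncomputable def doubled (F G : ℝ → ℝ → ℝ) (ε δ l : ℝ) (x t y s : ℝ) : ℝ :=
  F x t - G y s - ((x - y) ^ 2 + (t - s) ^ 2) / (2 * ε) - δ * x - l * (t + t ^ 2)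

lemma doubled_le {F G : ℝ → ℝ → ℝ} {K ε δ l : ℝ} (hε : 0 < ε)
    (hG : QuadrantLip K G)
    {x t y s : ℝ} (hx : 0 ≤ x) (ht : 0 ≤ t) (hy : 0 ≤ y) (hs : 0 ≤ s) :
    doubled F G ε δ l x t y s ≤ F x t - G x t + K ^ 2 * ε - δ * x - l * (t + t ^ 2) := by
  have h1 := abs_le.1 (hG x t y s hx ht hy hs)
  have h2 : K * (|x - y| + |t - s|) ≤ ((x - y) ^ 2 + (t - s) ^ 2) / (2 * ε) + K ^ 2 * ε := by
    rw [← sub_le_iff_le_add, le_div_iff₀ (by positivity), ← sq_abs (x - y), ← sq_abs (t - s)]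
    nlinarith [sq_nonneg (|x - y| - K * ε), sq_nonneg (|t - s| - K * ε)]
  unfold doubled
  linarith [h1.2]

/-- At a point where doubling does not lose against the diagonal, the two points are close. -/
lemma doubled_close {F G : ℝ → ℝ → ℝ} {K ε δ l : ℝ} (hε : 0 < ε) (hK : 0 ≤ K)
    (hG : QuadrantLip K G)
    {x t y s : ℝ} (hx : 0 ≤ x) (ht : 0 ≤ t) (hy : 0 ≤ y) (hs : 0 ≤ s)
    (h : doubled F G ε δ l x t x t ≤ doubled F G ε δ l x t y s) :
    |x - y| + |t - s| ≤ 4 * K * ε := by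
  have h1 := abs_le.1 (hG x t y s hx ht hy hs)
  have h2 : ((x - y) ^ 2 + (t - s) ^ 2) / (2 * ε) ≤ K * (|x - y| + |t - s|) := by
    unfold doubled at h
    simp only [sub_self, ne_eq, OfNat.ofNat_ne_zero, not_false_eq_true, zero_pow, add_zero,
      zero_div, sub_zero] at h
    linarith [h1.2]
  rw [div_le_iff₀ (by positivity), ← sq_abs (x - y), ← sq_abs (t - s)] at h2
  have ha := abs_nonneg (x - y)
  have hb := abs_nonneg (t - s)
  by_contra! hc
  have : 0 < |x - y| + |t - s| := lt_of_le_of_lt (by positivity) hc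
  nlinarith [sq_nonneg (|x - y| - |t - s|), mul_lt_mul_of_pos_right hc this]

/-- The doubled functional attains a local maximum at which its value is at least its value at
a given diagonal point where it is positive. -/
lemma exists_doubled_max {m K ε δ l : ℝ} {F G : ℝ → ℝ → ℝ}
    (hm : 0 ≤ m) (hK : 0 ≤ K) (hε : 0 < ε) (hε1 : ε ≤ 1) (hεK : 4 * K * ε < 1)
    (hδ : 0 < δ) (hl : 0 < l)
    (hF : QuadrantLip K F) (hG : QuadrantLip K G) (hFs : Sublinear (fun x => F x 0))
    (hFb : ∀ x t, 0 ≤ x → 0 ≤ t → F x t ≤ m * x) (hGb : ∀ x t, 0 ≤ x → 0 ≤ t → 0 ≤ G x t)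
    (h0 : ∀ x, 0 ≤ x → F x 0 ≤ G x 0)
    {x₁ t₁ : ℝ} (hx₁ : 0 ≤ x₁) (ht₁ : 0 ≤ t₁) (hpos : 0 < doubled F G ε δ l x₁ t₁ x₁ t₁) :
    ∃ x t y s : ℝ, 0 ≤ x ∧ 0 ≤ t ∧ 0 ≤ y ∧ 0 ≤ s ∧ |x - y| + |t - s| ≤ 4 * K * ε ∧
      doubled F G ε δ l x₁ t₁ x₁ t₁ ≤ doubled F G ε δ l x t y s ∧
      IsLocalMaxOn (fun p : ℝ × ℝ => doubled F G ε δ l p.1 p.2 y s) (Ici 0 ×ˢ Ici 0) (x, t) ∧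
      IsLocalMaxOn (fun p : ℝ × ℝ => doubled F G ε δ l x t p.1 p.2) (Ici 0 ×ˢ Ici 0) (y, s) := by
  obtain ⟨A, hA0, hA⟩ := hFs.exists_le_add hm (fun x hx => hFb x 0 hx le_rfl)
    (half_pos hδ)
  set T : ℝ := (2 * K + K ^ 2) / l + 1 with hT
  have hT0 : 1 ≤ T := by
    have : 0 ≤ (2 * K + K ^ 2) / l := by positivity
    linarith
  set R : ℝ := 2 * (A + K * T) / δ with hR
  have hR0 : 0 ≤ R := by positivity
  have bound : ∀ x t y s : ℝ, 0 ≤ x → 0 ≤ t → 0 ≤ y → 0 ≤ s →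
      0 < doubled F G ε δ l x t y s → x ≤ R ∧ t ≤ T := by
    intro x t y s hx ht hy hs h
    have htT : t ≤ T := by
      by_contra! hc
      have h1 := h.trans_le (doubled_le hε hG hx ht hy hs)
      have h2 := abs_le.1 (hF x t x 0 hx ht hx le_rfl)
      have h3 := abs_le.1 (hG x t x 0 hx ht hx le_rfl)
      rw [sub_self, abs_zero, zero_add, sub_zero, abs_of_nonneg ht] at h2 h3
      have h4 := h0 x hx
      have h5 : 2 * K + K ^ 2 ≤ l * t := by
        have : (2 * K + K ^ 2) / l ≤ t := by linarith
        rwa [div_le_iff₀ hl, mul_comm t l] at this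
      have h6 : (2 * K + K ^ 2) * t ≤ l * t * t := mul_le_mul_of_nonneg_right h5 ht
      have h7 : K ^ 2 * ε ≤ K ^ 2 := mul_le_of_le_one_right (sq_nonneg K) hε1
      have h8 : K ^ 2 ≤ K ^ 2 * t := le_mul_of_one_le_right (sq_nonneg K) (by linarith)
      have h9 : 0 ≤ δ * x := by positivity
      have h10 : 0 ≤ l * t := by positivity
      nlinarith [h2.2, h3.1]
    refine ⟨?_, htT⟩
    have h2 := (abs_le.1 (hF x t x 0 hx ht hx le_rfl)).2
    rw [sub_self, abs_zero, zero_add, sub_zero, abs_of_nonneg ht] at h2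
    have h3 := hA x hx
    have h4 := hGb y s hy hs
    have h5 : 0 ≤ ((x - y) ^ 2 + (t - s) ^ 2) / (2 * ε) := by positivity
    have h6 : 0 ≤ l * (t + t ^ 2) := by positivity
    have h7 : K * t ≤ K * T := mul_le_mul_of_nonneg_left htT hK
    unfold doubled at h
    rw [hR, le_div_iff₀ hδ]
    linarith
  have bound₁ := bound x₁ t₁ x₁ t₁ hx₁ ht₁ hx₁ ht₁ hpos
  set Q : Set (ℝ × ℝ) := Icc 0 (R + 1) ×ˢ Icc 0 (T + 1) with hQ
  have hQc : IsCompact Q := isCompact_Icc.prod isCompact_Icc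
  have hQs : Q ⊆ Ici 0 ×ˢ Ici 0 := prod_mono Icc_subset_Ici_self Icc_subset_Ici_self
  have hcont : ContinuousOn
      (fun z : (ℝ × ℝ) × (ℝ × ℝ) => doubled F G ε δ l z.1.1 z.1.2 z.2.1 z.2.2) (Q ×ˢ Q) := by
    have hFc : ContinuousOn (fun z : (ℝ × ℝ) × (ℝ × ℝ) => F z.1.1 z.1.2) (Q ×ˢ Q) :=
      (hF.continuousOn hK).comp continuousOn_fst (fun z hz => hQs hz.1)
    have hGc : ContinuousOn (fun z : (ℝ × ℝ) × (ℝ × ℝ) => G z.2.1 z.2.2) (Q ×ˢ Q) :=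
      (hG.continuousOn hK).comp continuousOn_snd (fun z hz => hQs hz.2)
    unfold doubled
    refine ((hFc.sub hGc).sub ?_ |>.sub ?_).sub ?_ <;> fun_prop
  have hz₁ : (((x₁, t₁), (x₁, t₁)) : (ℝ × ℝ) × (ℝ × ℝ)) ∈ Q ×ˢ Q :=
    ⟨⟨⟨hx₁, by linarith⟩, ⟨ht₁, by linarith⟩⟩, ⟨⟨hx₁, by linarith⟩, ⟨ht₁, by linarith⟩⟩⟩
  obtain ⟨⟨⟨x, t⟩, ⟨y, s⟩⟩, ⟨hxt, hys⟩, hmax⟩ := (hQc.prod hQc).exists_isMaxOn ⟨_, hz₁⟩ hcont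
  have hmax' : ∀ x' t' y' s', (x', t') ∈ Q → (y', s') ∈ Q →
      doubled F G ε δ l x' t' y' s' ≤ doubled F G ε δ l x t y s := fun x' t' y' s' h h' =>
    hmax (show ((x', t'), (y', s')) ∈ Q ×ˢ Q from ⟨h, h'⟩)
  have hx : 0 ≤ x := (hQs hxt).1
  have ht : 0 ≤ t := (hQs hxt).2
  have hy : 0 ≤ y := (hQs hys).1
  have hs : 0 ≤ s := (hQs hys).2
  have hval := hmax' _ _ _ _ hz₁.1 hz₁.2
  have hclose := doubled_close hε hK hG hx ht hy hs (hmax' _ _ _ _ hxt hxt)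
  obtain ⟨hxR, htT⟩ := bound x t y s hx ht hy hs (hpos.trans_le hval)
  have hnhds : ∀ p : ℝ × ℝ, p.1 < R + 1 → p.2 < T + 1 → ∀ᶠ q in 𝓝[Ici 0 ×ˢ Ici 0] p, q ∈ Q := by
    intro p h1 h2
    have e1 : ∀ᶠ q : ℝ × ℝ in 𝓝 p, q.1 < R + 1 := continuous_fst.continuousAt.eventually_lt_const h1
    have e2 : ∀ᶠ q : ℝ × ℝ in 𝓝 p, q.2 < T + 1 := continuous_snd.continuousAt.eventually_lt_const h2
    filter_upwards [e1.filter_mono nhdsWithin_le_nhds, e2.filter_mono nhdsWithin_le_nhds,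
      self_mem_nhdsWithin] with q q1 q2 q3
    exact ⟨⟨q3.1, q1.le⟩, ⟨q3.2, q2.le⟩⟩
  have hc1 : y - x < 1 := by
    linarith [neg_abs_le (x - y), abs_nonneg (t - s)]
  have hc2 : s - t < 1 := by
    linarith [neg_abs_le (t - s), abs_nonneg (x - y)]
  refine ⟨x, t, y, s, hx, ht, hy, hs, hclose, hval, ?_, ?_⟩
  · filter_upwards [hnhds (x, t) (by simp only; linarith) (by simp only; linarith)] with q hq
    exact hmax' _ _ _ _ hq hys
  · filter_upwards [hnhds (y, s) (by simp only; linarith) (by simp only; linarith)] with q hq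
    exact hmax' _ _ _ _ hxt hq

/-- Comparison principle for (HJ). -/
theorem comparison_HJ {m : ℝ} (hm : 0 < m) {F G : ℝ → ℝ → ℝ} {K : ℝ} (hK : 0 ≤ K)
    (hF : QuadrantLip K F) (hG : QuadrantLip K G) (hFs : Sublinear (fun x => F x 0))
    (hFb : ∀ x t, 0 ≤ x → 0 ≤ t → F x t ≤ m * x)
    (hGb : ∀ x t, 0 ≤ x → 0 ≤ t → 0 ≤ G x t ∧ G x t ≤ m * x)
    (h0 : ∀ x, 0 ≤ x → F x 0 ≤ G x 0)
    (hsub : IsSubsolutionHJ m F) (hsup : IsSupersolutionHJ m G)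
    {x₁ t₁ : ℝ} (hx₁ : 0 ≤ x₁) (ht₁ : 0 ≤ t₁) : F x₁ t₁ ≤ G x₁ t₁ := by
  by_contra! hlt
  set W := F x₁ t₁ - G x₁ t₁ with hW
  have hW0 : 0 < W := sub_pos.2 hlt
  obtain ⟨l, hl, hl1⟩ : ∃ l > 0, l * (t₁ + t₁ ^ 2) ≤ W / 4 := by
    refine ⟨W / 4 / (1 + t₁ + t₁ ^ 2), by positivity, ?_⟩
    rw [div_mul_eq_mul_div, div_le_iff₀ (by positivity)]
    nlinarith
  obtain ⟨δ, hδ, hδ1, hδ2⟩ : ∃ δ > 0, δ * x₁ ≤ W / 4 ∧ δ * (4 * K + m + 1) ≤ l / 4 := by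
    refine ⟨min (W / 4 / (x₁ + 1)) (l / 4 / (4 * K + m + 1)), by positivity, ?_, ?_⟩
    · refine (mul_le_mul_of_nonneg_right (min_le_left _ _) hx₁).trans ?_
      rw [div_mul_eq_mul_div, div_le_iff₀ (by positivity)]
      nlinarith
    · refine (mul_le_mul_of_nonneg_right (min_le_right _ _) (by positivity)).trans ?_
      rw [div_mul_cancel₀ _ (by positivity)]
  obtain ⟨ε, hε, hε1, hε2, hε3, hε4⟩ : ∃ ε > 0, ε ≤ 1 ∧ 4 * K * ε < 1 ∧
      8 * K ^ 2 * ε < W / 2 ∧ m ^ 2 * (4 * K * ε) ≤ l / 4 * (W / 2) ∧ m * (4 * K * ε) < W / 2 := by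
    have hev : ∀ᶠ ε : ℝ in 𝓝[>] 0, ε ≤ 1 ∧ 4 * K * ε < 1 ∧
      8 * K ^ 2 * ε < W / 2 ∧ m ^ 2 * (4 * K * ε) ≤ l / 4 * (W / 2) ∧ m * (4 * K * ε) < W / 2 := by
      have key : ∀ c b : ℝ, 0 < b → ∀ᶠ ε : ℝ in 𝓝[>] 0, c * ε < b := by
        intro c b hb
        have : Tendsto (fun ε : ℝ => c * ε) (𝓝 0) (𝓝 (c * 0)) := by
          exact (continuous_const_mul c).tendsto 0
        rw [mul_zero] at this
        exact (this.eventually_lt_const hb).filter_mono nhdsWithin_le_nhds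
      filter_upwards [key 1 1 one_pos, key (4 * K) 1 one_pos, key (8 * K ^ 2) (W / 2) (by positivity),
        key (m ^ 2 * (4 * K)) (l / 4 * (W / 2)) (by positivity),
        key (m * (4 * K)) (W / 2) (by positivity)] with ε h1 h2 h3 h4 h5
      refine ⟨by linarith, h2, h3, by linarith, by linarith⟩
    obtain ⟨ε, h1, h2⟩ := (hev.and self_mem_nhdsWithin).exists
    exact ⟨ε, h2, h1⟩
  have hΘ : W / 2 ≤ doubled F G ε δ l x₁ t₁ x₁ t₁ := by
    unfold doubled
    simp only [sub_self, ne_eq, OfNat.ofNat_ne_zero, not_false_eq_true, zero_pow, add_zero,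
      zero_div, sub_zero]
    linarith
  obtain ⟨x, t, y, s, hx, ht, hy, hs, hclose, hval, hmax1, hmax2⟩ :=
    exists_doubled_max hm.le hK hε hε1 hε2 hδ hl hF hG hFs hFb (fun x t hx ht => (hGb x t hx ht).1)
      h0 hx₁ ht₁ (lt_of_lt_of_le (by positivity) hΘ)
  have hval' := hΘ.trans hval
  have hax : |x - y| ≤ 4 * K * ε := by linarith [abs_nonneg (t - s)]
  have hat : |t - s| ≤ 4 * K * ε := by linarith [abs_nonneg (x - y)]
  have hq : 0 ≤ ((x - y) ^ 2 + (t - s) ^ 2) / (2 * ε) := by positivity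
  have hFG : W / 2 ≤ F x t - G y s := by
    unfold doubled at hval'
    have h1 : 0 ≤ δ * x := by positivity
    have h2 : 0 ≤ l * (t + t ^ 2) := by positivity
    linarith
  have hG0 := (hGb y s hy hs).1
  have hG1 := (hGb y s hy hs).2
  have hxlow : W / 2 ≤ m * x := by linarith [hFb x t hx ht]
  have hxpos : 0 < x := pos_of_mul_pos_right (lt_of_lt_of_le (by positivity) hxlow) hm.le
  have hypos : 0 < y := by
    have h1 : x - 4 * K * ε ≤ y := by linarith [le_abs_self (x - y)]
    have h2 : 0 < m * (x - 4 * K * ε) := by linarith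
    exact (pos_of_mul_pos_right h2 hm.le).trans_le h1
  have hinit : F x t - G y s ≤ K * (t + |x - y| + s) := by
    have e1 := (abs_le.1 (hF x t x 0 hx ht hx le_rfl)).2
    have e2 := (abs_le.1 (hG y s x 0 hy hs hx le_rfl)).1
    rw [sub_self, abs_zero, zero_add, sub_zero, abs_of_nonneg ht] at e1
    rw [sub_zero, abs_of_nonneg hs, abs_sub_comm] at e2
    have := h0 x hx
    linarith
  have htpos : 0 < t := by
    rcases ht.eq_or_lt with h | h
    · exfalso
      have : s ≤ 4 * K * ε := by
        rw [← h, zero_sub, abs_neg, abs_of_nonneg hs] at hat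
        exact hat
      have : K * (t + |x - y| + s) ≤ K * (4 * K * ε + 4 * K * ε) :=
        mul_le_mul_of_nonneg_left (by linarith) hK
      linarith
    · exact h
  have hspos : 0 < s := by
    rcases hs.eq_or_lt with h | h
    · exfalso
      have : t ≤ 4 * K * ε := by
        rw [← h, sub_zero, abs_of_nonneg ht] at hat
        exact hat
      have : K * (t + |x - y| + s) ≤ K * (4 * K * ε + 4 * K * ε) :=
        mul_le_mul_of_nonneg_left (by linarith) hK
      linarith
    · exact h
  set p := (x - y) / ε with hp
  set τ := (t - s) / ε with hτ
  have hFt := hsub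
    (fun q => ((q.1 - y) ^ 2 + (q.2 - s) ^ 2) / (2 * ε) + δ * q.1 + l * (q.2 + q.2 ^ 2))
    (by fun_prop) x t hxpos htpos (by
      filter_upwards [hmax1] with q hq
      simp only [doubled] at hq
      linarith)
  have hGt := hsup (fun q => -(((x - q.1) ^ 2 + (t - q.2) ^ 2) / (2 * ε))) (by fun_prop) y s
    hypos hspos (by
      filter_upwards [hmax2] with q hq
      simp only [doubled] at hq
      linarith)
  have d1 : deriv (fun r => ((x - y) ^ 2 + (r - s) ^ 2) / (2 * ε) + δ * x + l * (r + r ^ 2)) t =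
      τ + l * (1 + 2 * t) := by
    refine HasDerivAt.deriv ?_
    have h1 := ((((hasDerivAt_id t).sub_const s).pow 2).const_add ((x - y) ^ 2)).div_const (2 * ε)
    have h2 := ((hasDerivAt_id t).add ((hasDerivAt_id t).pow 2)).const_mul l
    exact ((h1.add_const (δ * x)).add h2).congr_deriv (by simp [hτ]; field_simp)
  have d2 : deriv (fun r => ((r - y) ^ 2 + (t - s) ^ 2) / (2 * ε) + δ * r + l * (t + t ^ 2)) x =
      p + δ := by
    refine HasDerivAt.deriv ?_
    have h1 := ((((hasDerivAt_id x).sub_const y).pow 2).add_const ((t - s) ^ 2)).div_const (2 * ε)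
    have h2 := (hasDerivAt_id x).const_mul δ
    exact ((h1.add h2).add_const (l * (t + t ^ 2))).congr_deriv (by simp [hp]; field_simp)
  have d3 : deriv (fun r => -(((x - y) ^ 2 + (t - r) ^ 2) / (2 * ε))) s = τ := by
    refine HasDerivAt.deriv ?_
    have h1 := (((((hasDerivAt_id s).const_sub t).pow 2).const_add
      ((x - y) ^ 2)).div_const (2 * ε)).neg
    exact h1.congr_deriv (by simp [hτ]; field_simp)
  have d4 : deriv (fun r => -(((x - r) ^ 2 + (t - s) ^ 2) / (2 * ε))) y = p := by
    refine HasDerivAt.deriv ?_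
    have h1 := (((((hasDerivAt_id y).const_sub x).pow 2).add_const
      ((t - s) ^ 2)).div_const (2 * ε)).neg
    exact h1.congr_deriv (by simp [hp]; field_simp)
  simp only [d1, d2] at hFt
  simp only [d3, d4] at hGt
  have hpK : |p| ≤ 4 * K := by
    rw [hp, abs_div, abs_of_pos hε, div_le_iff₀ hε]
    exact hax
  have hpK' := neg_le_of_abs_le hpK
  have hδp : -(l / 4) ≤ δ * (p - m - 1 / 2) := by
    have := mul_le_mul_of_nonneg_left
      (show -(4 * K + m + 1) ≤ p - m - 1 / 2 by linarith) hδ.le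
    linarith
  have hquot : -(l / 4) ≤ F x t / x - G y s / y := by
    have h1 : G y s / x ≤ F x t / x := by gcongr; linarith
    have h2 : G y s / y - G y s / x ≤ l / 4 := by
      have e : G y s / y - G y s / x = G y s / y * ((x - y) / x) := by field_simp
      have e1 : G y s / y ≤ m := by rwa [div_le_iff₀ hypos]
      have e0 : 0 ≤ G y s / y := by positivity
      have e2 : (x - y) / x ≤ l / 4 / m := by
        rw [div_le_div_iff₀ hxpos hm]
        have a1 : (x - y) * m ≤ 4 * K * ε * m :=
          mul_le_mul_of_nonneg_right ((le_abs_self _).trans hax) hm.le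
        have a2 : l / 4 * (W / 2) ≤ l / 4 * (m * x) := mul_le_mul_of_nonneg_left hxlow (by positivity)
        have a3 : m * (4 * K * ε * m) ≤ m * (l / 4 * x) := by linarith
        exact a1.trans (le_of_mul_le_mul_left a3 hm)
      calc G y s / y - G y s / x = G y s / y * ((x - y) / x) := e
        _ ≤ G y s / y * (l / 4 / m) := mul_le_mul_of_nonneg_left e2 e0
        _ ≤ m * (l / 4 / m) := mul_le_mul_of_nonneg_right e1 (by positivity)
        _ = l / 4 := by field_simp
    linarith
  have hlt2 : 0 ≤ l * (2 * t) := by positivity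
  have hexp : 1 / 2 * (p + δ - m) * (p + δ - m - 1) =
      1 / 2 * (p - m) * (p - m - 1) + δ * (p - m - 1 / 2) + δ ^ 2 / 2 := by ring
  linarith [sq_nonneg δ]

/-- The running cost, convex conjugate of the Hamiltonian `p ↦ (p - m) (p - m - 1) / 2 - m`. -/
noncomputable def cost (m v : ℝ) : ℝ := 1 / 2 * (v + 1 / 2) ^ 2 + m * v + m

lemma mul_sub_cost_le (m p v : ℝ) :
    v * p - cost m v ≤ 1 / 2 * (p - m) * (p - m - 1) - m := by
  unfold cost
  nlinarith [sq_nonneg (v + 1 / 2 - (p - m))]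

lemma mul_sub_cost_eq (m p : ℝ) :
    (p - m - 1 / 2) * p - cost m (p - m - 1 / 2) = 1 / 2 * (p - m) * (p - m - 1) - m := by
  unfold cost
  ring

lemma half_sq_le_cost {m : ℝ} (hm₀ : 0 ≤ m) (hm₁ : m ≤ 1) (v : ℝ) :
    1 / 2 * (v + 1 / 2 + m) ^ 2 ≤ cost m v := by
  unfold cost
  nlinarith

/-- The cost is superlinear. -/
lemma abs_le_of_cost_le {m : ℝ} (hm₀ : 0 ≤ m) (hm₁ : m ≤ 1) {a b v : ℝ} (ha : 0 ≤ a) (hb : 0 ≤ b)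
    (h : cost m v ≤ a * |v| + b) : |v| ≤ 2 * a + 2 * b + 2 * m + 2 := by
  have h1 := half_sq_le_cost hm₀ hm₁ v
  by_contra! hc
  have h2 := neg_abs_le v
  have h3 : |v| ^ 2 = v ^ 2 := sq_abs v
  have h4 : (2 * a + 2 * b + 2 * m + 2) * |v| ≤ |v| * |v| :=
    mul_le_mul_of_nonneg_right hc.le (abs_nonneg v)
  have h5 : b ≤ b * |v| := le_mul_of_one_le_right hb (by linarith)
  have h6 : m * -|v| ≤ m * v := mul_le_mul_of_nonneg_left h2 hm₀
  nlinarith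

/-- A family, indexed by the step `h > 0`, of solutions to the time-discretized equation. -/
structure DiscreteHJ (m C : ℝ) (F₀ : ℝ → ℝ) (u : ℝ → ℝ → ℝ → ℝ) : Prop where
  nonneg : ∀ h > 0, ∀ x t, 0 ≤ x → 0 ≤ t → 0 ≤ u h x t
  le_mul : ∀ h > 0, ∀ x t, 0 ≤ x → 0 ≤ t → u h x t ≤ m * x
  initial : ∀ h > 0, ∀ x, 0 ≤ x → u h x 0 = F₀ x
  almost_lip : ∀ h > 0, ∀ x t y s, 0 ≤ x → 0 ≤ t → 0 ≤ y → 0 ≤ s →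
    |u h x t - u h y s| ≤ C * (|x - y| + |t - s| + h)
  le_step : ∀ h > 0, ∀ x t y, 0 < x → h ≤ t → 0 ≤ y →
    u h x t * (1 + h / x) ≤ u h y (t - h) + h * cost m ((x - y) / h)
  exists_step : ∀ h > 0, ∀ x t η, 0 < x → h ≤ t → 0 < η →
    ∃ y, 0 ≤ y ∧ u h y (t - h) + h * cost m ((x - y) / h) < u h x t * (1 + h / x) + η

section Stability

variable {U : Ultrafilter ℝ}

lemma tendsto_id_of_le (hU : (U : Filter ℝ) ≤ 𝓝[>] 0) : Tendsto (fun h : ℝ => h) U (𝓝 0) :=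
  hU.trans nhdsWithin_le_nhds

lemma eventually_pos_of_le (hU : (U : Filter ℝ) ≤ 𝓝[>] 0) : ∀ᶠ h : ℝ in U, 0 < h :=
  hU self_mem_nhdsWithin

lemma exists_tendsto_of_mem_compact {E : Type*} [TopologicalSpace E] {K : Set E} (hK : IsCompact K)
    {g : ℝ → E} (hg : ∀ᶠ h in U, g h ∈ K) : ∃ a ∈ K, Tendsto g U (𝓝 a) := by
  obtain ⟨a, ha, h⟩ := hK.ultrafilter_le_nhds (U.map g) (le_principal_iff.2 hg)
  exact ⟨a, ha, h⟩

/-- Almost minimizers of approximations converge to a strict minimizer of the limit. -/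
lemma exists_almost_minimizers {E : Type*} [PseudoMetricSpace E]
    (hU : (U : Filter ℝ) ≤ 𝓝[>] 0) {v : ℝ → E → ℝ} {f ψ : E → ℝ} {C : ℝ}
    {B : Set E} (hB : IsCompact B) {p₀ : E} (hp₀ : p₀ ∈ B) (hC : 0 ≤ C)
    (hv : ∀ h > 0, ∀ p ∈ B, ∀ q ∈ B, |v h p - v h q| ≤ C * (dist p q + h))
    (hlim : ∀ p ∈ B, Tendsto (fun h => v h p) U (𝓝 (f p)))
    (hψ : Continuous ψ) (hmin : ∀ q ∈ B, q ≠ p₀ → f p₀ - ψ p₀ < f q - ψ q) :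
    ∃ p : ℝ → E, Tendsto p U (𝓝 p₀) ∧ Tendsto (fun h => v h (p h)) U (𝓝 (f p₀)) ∧
      ∀ h > 0, ∀ q ∈ B, v h (p h) - ψ (p h) ≤ v h q - ψ q + h ^ 2 := by
  have hex : ∀ h : ℝ, ∃ p : E, 0 < h →
      p ∈ B ∧ ∀ q ∈ B, v h p - ψ p ≤ v h q - ψ q + h ^ 2 := by
    intro h
    by_cases hh : 0 < h
    swap
    · exact ⟨p₀, fun h' => absurd h' hh⟩
    obtain ⟨M, hM⟩ := hB.bddAbove_image hψ.continuousOn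
    have hbdd : BddBelow ((fun q => v h q - ψ q) '' B) := by
      refine ⟨v h p₀ - C * (Metric.diam B + h) - M, ?_⟩
      rintro _ ⟨q, hq, rfl⟩
      have h1 := (abs_le.1 (hv h hh p₀ hp₀ q hq)).2
      have h2 : C * (dist p₀ q + h) ≤ C * (Metric.diam B + h) := by
        gcongr
        exact Metric.dist_le_diam_of_mem hB.isBounded hp₀ hq
      have h3 : ψ q ≤ M := hM ⟨q, hq, rfl⟩
      simp only
      linarith
    obtain ⟨_, ⟨p, hp, rfl⟩, hlt⟩ := exists_lt_of_csInf_lt (s := (fun q => v h q - ψ q) '' B)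
      (b := sInf ((fun q => v h q - ψ q) '' B) + h ^ 2) ⟨_, p₀, hp₀, rfl⟩
      (lt_add_of_pos_right _ (by positivity))
    refine ⟨p, fun _ => ⟨hp, fun q hq => hlt.le.trans ?_⟩⟩
    exact add_le_add_left (csInf_le hbdd ⟨q, hq, rfl⟩) _
  choose p hp using hex
  obtain ⟨a, haB, ha⟩ := exists_tendsto_of_mem_compact (U := U) hB (g := p)
    ((eventually_pos_of_le hU).mono fun h hh => (hp h hh).1)
  have hva : Tendsto (fun h => v h (p h)) U (𝓝 (f a)) := by
    refine (hlim a haB).congr_dist (squeeze_zero' (Eventually.of_forall fun _ => dist_nonneg)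
      ((eventually_pos_of_le hU).mono fun h hh => ?_)
      (g := fun h => C * (dist a (p h) + h)) ?_)
    · rw [Real.dist_eq]
      exact hv h hh a haB (p h) (hp h hh).1
    · have h1 := ((tendsto_const_nhds (x := a)).dist ha).add (tendsto_id_of_le hU)
      simpa using h1.const_mul C
  have hle : f a - ψ a ≤ f p₀ - ψ p₀ := by
    have h1 := hva.sub ((hψ.tendsto a).comp ha)
    have h2 := ((hlim p₀ hp₀).sub_const (ψ p₀)).add ((tendsto_id_of_le hU).pow 2)
    simp only [ne_eq, OfNat.ofNat_ne_zero, not_false_eq_true, zero_pow, add_zero] at h2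
    exact le_of_tendsto_of_tendsto h1 h2
      ((eventually_pos_of_le hU).mono fun h hh => (hp h hh).2 p₀ hp₀)
  have hap : a = p₀ := by
    by_contra hne
    exact absurd (hmin a haB hne) (not_lt.2 hle)
  subst hap
  exact ⟨p, ha, hva, fun h hh => (hp h hh).2⟩

/-- Difference quotients along moving base points and directions. -/
lemma HasStrictFDerivAt.tendsto_div {E : Type*} [NormedAddCommGroup E] [NormedSpace ℝ E]
    (hU : (U : Filter ℝ) ≤ 𝓝[>] 0) {ψ : E → ℝ} {L : E →L[ℝ] ℝ} {p₀ : E}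
    (hψ : HasStrictFDerivAt ψ L p₀) {p w : ℝ → E} {w₀ : E} (hp : Tendsto p U (𝓝 p₀))
    (hw : Tendsto w U (𝓝 w₀)) :
    Tendsto (fun h => (ψ (p h) - ψ (p h - h • w h)) / h) U (𝓝 (L w₀)) := by
  have hhw : Tendsto (fun h => h • w h) U (𝓝 0) := by
    simpa using (tendsto_id_of_le hU).smul hw
  have hq : Tendsto (fun h => p h - h • w h) U (𝓝 p₀) := by
    simpa using hp.sub hhw
  have h1 := hψ.isLittleO.comp_tendsto (hp.prodMk_nhds hq)
  have h2 : (fun h => h • w h) =O[(U : Filter ℝ)] fun h : ℝ => h := by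
    simpa using (Asymptotics.isBigO_refl (fun h : ℝ => h) (U : Filter ℝ)).smul (hw.isBigO_one ℝ)
  have h3 : (fun h => ψ (p h) - ψ (p h - h • w h) - L (h • w h)) =o[(U : Filter ℝ)]
      fun h : ℝ => h := by
    refine Asymptotics.IsLittleO.trans_isBigO ?_ h2
    simpa [Function.comp_def] using h1
  have h4 := h3.tendsto_div_nhds_zero.add ((L.continuous.tendsto w₀).comp hw)
  rw [zero_add] at h4
  refine h4.congr' ((eventually_pos_of_le hU).mono fun h hh => ?_)
  simp only [Function.comp_apply, map_smul, smul_eq_mul]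
  field_simp
  ring

lemma hasStrictFDerivAt_sq_add_sq (p₀ : ℝ × ℝ) :
    HasStrictFDerivAt (fun q : ℝ × ℝ => (q.1 - p₀.1) ^ 2 + (q.2 - p₀.2) ^ 2)
      (0 : ℝ × ℝ →L[ℝ] ℝ) p₀ := by
  have h1 := ((hasStrictFDerivAt_fst (𝕜 := ℝ) (p := p₀)).sub_const p₀.1).pow 2
  have h2 := ((hasStrictFDerivAt_snd (𝕜 := ℝ) (p := p₀)).sub_const p₀.2).pow 2
  refine (h1.add h2).congr_fderiv ?_
  simp

lemma sq_add_sq_pos_of_ne {p q : ℝ × ℝ} (h : q ≠ p) :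
    0 < (q.1 - p.1) ^ 2 + (q.2 - p.2) ^ 2 := by
  by_contra! hc
  refine h (Prod.ext ?_ ?_) <;> nlinarith [sq_nonneg (q.1 - p.1), sq_nonneg (q.2 - p.2)]

lemma deriv_partial_eq {φ : ℝ × ℝ → ℝ} {L : ℝ × ℝ →L[ℝ] ℝ} {x t : ℝ}
    (h : HasStrictFDerivAt φ L (x, t)) :
    deriv (fun y => φ (y, t)) x = L (1, 0) ∧ deriv (fun s => φ (x, s)) t = L (0, 1) :=
  ⟨(h.hasFDerivAt.comp_hasDerivAt x ((hasDerivAt_id x).prodMk (hasDerivAt_const x t))).deriv,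
    (h.hasFDerivAt.comp_hasDerivAt t ((hasDerivAt_const t x).prodMk (hasDerivAt_id t))).deriv⟩

lemma exists_closedBall_of_eventually {P : ℝ × ℝ → Prop} {x t : ℝ} (hx : 0 < x) (ht : 0 < t)
    (h : ∀ᶠ q in 𝓝[Ici 0 ×ˢ Ici 0] (x, t), P q) :
    ∃ r > 0, ∀ q ∈ Metric.closedBall (x, t) r, 0 < q.1 ∧ 0 < q.2 ∧ P q := by
  have hn : (Ici 0 ×ˢ Ici 0 : Set (ℝ × ℝ)) ∈ 𝓝 (x, t) := prod_mem_nhds (Ici_mem_nhds hx) (Ici_mem_nhds ht)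
  rw [nhdsWithin_eq_nhds.2 hn] at h
  have h1 : ∀ᶠ q : ℝ × ℝ in 𝓝 (x, t), 0 < q.1 := continuous_fst.continuousAt.eventually_const_lt hx
  have h2 : ∀ᶠ q : ℝ × ℝ in 𝓝 (x, t), 0 < q.2 := continuous_snd.continuousAt.eventually_const_lt ht
  obtain ⟨r, hr, hr'⟩ := Metric.nhds_basis_closedBall.mem_iff.1 (h1.and (h2.and h))
  exact ⟨r, hr, fun q hq => hr' hq⟩

variable {m C : ℝ} {F₀ : ℝ → ℝ} {u : ℝ → ℝ → ℝ → ℝ}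

lemma DiscreteHJ.dist_bound (hu : DiscreteHJ m C F₀ u) (hC : 0 ≤ C) {h : ℝ} (hh : 0 < h)
    {p q : ℝ × ℝ} (hp1 : 0 < p.1) (hp2 : 0 < p.2) (hq1 : 0 < q.1) (hq2 : 0 < q.2) :
    |u h p.1 p.2 - u h q.1 q.2| ≤ 2 * C * (dist p q + h) := by
  refine (hu.almost_lip h hh _ _ _ _ hp1.le hp2.le hq1.le hq2.le).trans ?_
  have h1 : |p.1 - q.1| ≤ dist p q := by
    rw [← Real.dist_eq, Prod.dist_eq]; exact le_max_left _ _
  have h2 : |p.2 - q.2| ≤ dist p q := by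
    rw [← Real.dist_eq, Prod.dist_eq]; exact le_max_right _ _
  nlinarith

lemma DiscreteHJ.isSubsolution (hu : DiscreteHJ m C F₀ u) (hC : 0 ≤ C)
    (hU : (U : Filter ℝ) ≤ 𝓝[>] 0) {F : ℝ → ℝ → ℝ}
    (hF : ∀ x t, 0 ≤ x → 0 ≤ t → Tendsto (fun h => u h x t) U (𝓝 (F x t))) :
    IsSubsolutionHJ m F := by
  intro φ hφ x₀ t₀ hx₀ ht₀ hmax
  obtain ⟨r, hr, hball⟩ := exists_closedBall_of_eventually hx₀ ht₀ hmax
  set B := Metric.closedBall (x₀, t₀) r with hB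
  have hφ' := hφ.contDiffAt.hasStrictFDerivAt (x := (x₀, t₀)) one_ne_zero
  set L := fderiv ℝ φ (x₀, t₀)
  set ψ : ℝ × ℝ → ℝ := fun q => φ q + ((q.1 - x₀) ^ 2 + (q.2 - t₀) ^ 2) with hψ
  have hψ' : HasStrictFDerivAt ψ L (x₀, t₀) :=
    (hφ'.add (hasStrictFDerivAt_sq_add_sq (x₀, t₀))).congr_fderiv (add_zero L)
  have hψc : Continuous ψ := by
    have := hφ.continuous
    fun_prop
  obtain ⟨p, hp, hup, hpmin⟩ := exists_almost_minimizers hU (v := fun h q => -u h q.1 q.2)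
    (f := fun q => -F q.1 q.2) (ψ := fun q => -ψ q) (B := B)
    (isCompact_closedBall _ _) (Metric.mem_closedBall_self hr.le) (C := 2 * C) (by positivity)
    (fun h hh p hp q hq => by
      rw [neg_sub_neg, abs_sub_comm]
      exact hu.dist_bound hC hh (hball p hp).1 (hball p hp).2.1 (hball q hq).1 (hball q hq).2.1)
    (fun q hq => (hF _ _ (hball q hq).1.le (hball q hq).2.1.le).neg) hψc.neg
    (fun q hq hne => by
      have h1 := (hball q hq).2.2
      have h2 := sq_add_sq_pos_of_ne hne
      simp only [hψ, sub_self] at h1 h2 ⊢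
      linarith)
  obtain ⟨d1, d2⟩ := deriv_partial_eq hφ'
  rw [d1, d2]
  set v := L (1, 0) - m - 1 / 2 with hv
  have hquot := hψ'.tendsto_div hU hp (tendsto_const_nhds (x := ((v, 1) : ℝ × ℝ)))
  have hq : Tendsto (fun h => p h - h • ((v, 1) : ℝ × ℝ)) U (𝓝 (x₀, t₀)) := by
    simpa using hp.sub ((tendsto_id_of_le hU).smul_const ((v, 1) : ℝ × ℝ))
  have hp1 : Tendsto (fun h => (p h).1) U (𝓝 x₀) := (continuous_fst.tendsto _).comp hp
  have hp2 : Tendsto (fun h => (p h).2) U (𝓝 t₀) := (continuous_snd.tendsto _).comp hp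
  have hBn : B ∈ 𝓝 (x₀, t₀) := Metric.closedBall_mem_nhds _ hr
  have hlimit : F x₀ t₀ / x₀ ≤ cost m v - L (v, 1) := by
    have h1 := (hup.neg.div hp1 hx₀.ne')
    have h2 := ((tendsto_id_of_le hU).const_add (cost m v)).sub hquot
    simp only [neg_neg, add_zero] at h1 h2
    refine le_of_tendsto_of_tendsto h1 h2 ?_
    filter_upwards [eventually_pos_of_le hU, hp.eventually_mem hBn, hq.eventually_mem hBn,
      (hp2.sub (tendsto_id_of_le hU)).eventually_const_lt (by simpa using ht₀)]
      with h hh hpB hqB hth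
    have e1 := hpmin h hh _ hqB
    have e2 := hu.le_step h hh (p h).1 (p h).2 ((p h).1 - h * v) (hball _ hpB).1 (by linarith)
      (by simpa using (hball _ hqB).1.le)
    rw [sub_sub_cancel, mul_div_cancel_left₀ _ hh.ne'] at e2
    simp only [Prod.fst_sub, Prod.smul_fst, smul_eq_mul, Prod.snd_sub, Prod.smul_snd,
      mul_one] at e1
    have e3 : h * (u h (p h).1 (p h).2 / (p h).1) ≤
        h * (cost m v + h - (ψ (p h) - ψ (p h - h • (v, 1))) / h) := by
      have e4 : h * ((ψ (p h) - ψ (p h - h • (v, 1))) / h) = ψ (p h) - ψ (p h - h • (v, 1)) :=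
        mul_div_cancel₀ _ hh.ne'
      have e5 : u h (p h).1 (p h).2 * (1 + h / (p h).1) =
        u h (p h).1 (p h).2 + h * (u h (p h).1 (p h).2 / (p h).1) := by ring
      rw [mul_sub, e4]
      linarith
    exact le_of_mul_le_mul_left e3 hh
  have hL : L (v, 1) = v * L (1, 0) + L (0, 1) := by
    rw [← smul_eq_mul, ← map_smul, ← map_add]
    simp
  have := mul_sub_cost_eq m (L (1, 0))
  rw [← hv] at this
  linarith

lemma DiscreteHJ.isSupersolution (hm₀ : 0 ≤ m) (hm₁ : m ≤ 1)
    (hu : DiscreteHJ m C F₀ u) (hC : 0 ≤ C)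
    (hU : (U : Filter ℝ) ≤ 𝓝[>] 0) {F : ℝ → ℝ → ℝ}
    (hF : ∀ x t, 0 ≤ x → 0 ≤ t → Tendsto (fun h => u h x t) U (𝓝 (F x t))) :
    IsSupersolutionHJ m F := by
  intro φ hφ x₀ t₀ hx₀ ht₀ hmin
  obtain ⟨r, hr, hball⟩ := exists_closedBall_of_eventually hx₀ ht₀ hmin
  set B := Metric.closedBall (x₀, t₀) r with hB
  have hφ' := hφ.contDiffAt.hasStrictFDerivAt (x := (x₀, t₀)) one_ne_zero
  set L := fderiv ℝ φ (x₀, t₀)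
  set ψ : ℝ × ℝ → ℝ := fun q => φ q - ((q.1 - x₀) ^ 2 + (q.2 - t₀) ^ 2) with hψ
  have hψ' : HasStrictFDerivAt ψ L (x₀, t₀) :=
    (hφ'.sub (hasStrictFDerivAt_sq_add_sq (x₀, t₀))).congr_fderiv (sub_zero L)
  have hψc : Continuous ψ := by
    have := hφ.continuous
    fun_prop
  obtain ⟨p, hp, hup, hpmin⟩ := exists_almost_minimizers hU (v := fun h q => u h q.1 q.2)
    (f := fun q => F q.1 q.2) (ψ := ψ) (B := B)
    (isCompact_closedBall _ _) (Metric.mem_closedBall_self hr.le) (C := 2 * C) (by positivity)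
    (fun h hh p hp q hq =>
      hu.dist_bound hC hh (hball p hp).1 (hball p hp).2.1 (hball q hq).1 (hball q hq).2.1)
    (fun q hq => hF _ _ (hball q hq).1.le (hball q hq).2.1.le) hψc
    (fun q hq hne => by
      have h1 := (hball q hq).2.2
      have h2 := sq_add_sq_pos_of_ne hne
      simp only [hψ, sub_self] at h1 h2 ⊢
      linarith)
  obtain ⟨d1, d2⟩ := deriv_partial_eq hφ'
  rw [d1, d2]
  have hp1 : Tendsto (fun h => (p h).1) U (𝓝 x₀) := (continuous_fst.tendsto _).comp hp
  have hp2 : Tendsto (fun h => (p h).2) U (𝓝 t₀) := (continuous_snd.tendsto _).comp hp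
  have hBn : B ∈ 𝓝 (x₀, t₀) := Metric.closedBall_mem_nhds _ hr
  have hgood : ∀ᶠ h in U, 0 < h ∧ h ≤ 1 ∧ p h ∈ B ∧ h ≤ (p h).2 := by
    filter_upwards [eventually_pos_of_le hU, hp.eventually_mem hBn,
      (tendsto_id_of_le hU).eventually_lt_const one_pos,
      (hp2.sub (tendsto_id_of_le hU)).eventually_const_lt (by simpa using ht₀)]
      with h hh hpB h1 hth
    exact ⟨hh, h1.le, hpB, by linarith⟩
  have hex : ∀ h, ∃ y, (0 < h ∧ h ≤ 1 ∧ p h ∈ B ∧ h ≤ (p h).2) →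
      0 ≤ y ∧ u h y ((p h).2 - h) + h * cost m (((p h).1 - y) / h) <
        u h (p h).1 (p h).2 * (1 + h / (p h).1) + h ^ 2 := by
    intro h
    by_cases hh : 0 < h ∧ h ≤ 1 ∧ p h ∈ B ∧ h ≤ (p h).2
    · obtain ⟨y, hy⟩ := hu.exists_step h hh.1 (p h).1 (p h).2 (h ^ 2) (hball _ hh.2.2.1).1 hh.2.2.2
        (pow_pos hh.1 2)
      exact ⟨y, fun _ => hy⟩
    · exact ⟨0, fun h' => absurd h' hh⟩
  choose y hy using hex
  have expand : ∀ h, u h (p h).1 (p h).2 * (1 + h / (p h).1) =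
      u h (p h).1 (p h).2 + h * (u h (p h).1 (p h).2 / (p h).1) := fun h => by ring
  obtain ⟨v₀, -, hv₀⟩ := exists_tendsto_of_mem_compact (U := U)
    (g := fun h => ((p h).1 - y h) / h) (K := Icc _ _) isCompact_Icc (by
      filter_upwards [hgood] with h hg
      obtain ⟨hy0, hy1⟩ := hy h hg
      obtain ⟨hh, hh1, hpB, hth⟩ := hg
      obtain ⟨hpx, hpt, -⟩ := hball _ hpB
      refine abs_le.1 (abs_le_of_cost_le hm₀ hm₁ hC (b := 2 * C + m + 1) (by positivity) ?_)
      have e1 := (abs_le.1 (hu.almost_lip h hh (p h).1 (p h).2 (y h) ((p h).2 - h) hpx.le hpt.le hy0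
        (by linarith))).2
      rw [sub_sub_cancel, abs_of_pos hh] at e1
      have e2 : |(p h).1 - y h| = h * |((p h).1 - y h) / h| := by
        rw [abs_div, abs_of_pos hh, mul_div_cancel₀ _ hh.ne']
      have e3 : u h (p h).1 (p h).2 / (p h).1 ≤ m := by
        rw [div_le_iff₀ hpx]
        exact hu.le_mul h hh _ _ hpx.le hpt.le
      have e4 : h * (u h (p h).1 (p h).2 / (p h).1) ≤ h * m := mul_le_mul_of_nonneg_left e3 hh.le
      have e5 : h ^ 2 ≤ h * 1 := by nlinarith
      rw [expand] at hy1
      rw [e2] at e1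
      refine le_of_mul_le_mul_left (a := h) ?_ hh
      linarith)
  have hw : Tendsto (fun h => ((((p h).1 - y h) / h, 1) : ℝ × ℝ)) U (𝓝 (v₀, 1)) :=
    hv₀.prodMk_nhds tendsto_const_nhds
  have hquot := hψ'.tendsto_div hU hp hw
  have hq : Tendsto (fun h => p h - h • ((((p h).1 - y h) / h, 1) : ℝ × ℝ)) U (𝓝 (x₀, t₀)) := by
    simpa using hp.sub ((tendsto_id_of_le hU).smul hw)
  have hlimit : cost m v₀ - L (v₀, 1) ≤ F x₀ t₀ / x₀ := by
    have hcost : Continuous (cost m) := by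
      unfold cost
      fun_prop
    have h1 := ((hcost.tendsto v₀).comp hv₀).sub hquot
    have h2 := (hup.div hp1 hx₀.ne').add ((tendsto_id_of_le hU).const_mul 2)
    simp only [mul_zero, add_zero] at h2
    refine le_of_tendsto_of_tendsto h1 h2 ?_
    filter_upwards [hgood, hq.eventually_mem hBn] with h hg hqB
    have e0 := (hy h hg).2
    obtain ⟨hh, hh1, hpB, hth⟩ := hg
    have e1 := hpmin h hh _ hqB
    have e6 : p h - h • ((((p h).1 - y h) / h, 1) : ℝ × ℝ) = (y h, (p h).2 - h) := by
      ext
      · simp [mul_div_cancel₀ _ hh.ne']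
      · simp
    rw [e6] at e1 ⊢
    rw [expand] at e0
    simp only [Function.comp_apply, Pi.div_apply] at e1 ⊢
    refine le_of_mul_le_mul_left (a := h) ?_ hh
    rw [mul_sub, mul_div_cancel₀ _ hh.ne', mul_add]
    linarith
  have hL : L (v₀, 1) = v₀ * L (1, 0) + L (0, 1) := by
    rw [← smul_eq_mul, ← map_smul, ← map_add]
    simp
  have := mul_sub_cost_le m (L (1, 0)) v₀
  linarith

/-- A uniformly almost Lipschitz discretization produces a solution in the limit of small steps. -/
theorem DiscreteHJ.exists_goodSolution (hm₀ : 0 ≤ m) (hm₁ : m ≤ 1)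
    (hu : DiscreteHJ m C F₀ u) (hC : 0 ≤ C) (hSub : Sublinear F₀) :
    ∃ F, GoodSolution m F₀ F := by
  have hU : (Ultrafilter.of (𝓝[>] (0 : ℝ)) : Filter ℝ) ≤ 𝓝[>] 0 := Ultrafilter.of_le _
  set U := Ultrafilter.of (𝓝[>] (0 : ℝ))
  have hpos := eventually_pos_of_le hU
  have hex : ∀ x t, ∃ l, 0 ≤ x → 0 ≤ t → Tendsto (fun h => u h x t) U (𝓝 l) := by
    intro x t
    by_cases hxt : 0 ≤ x ∧ 0 ≤ t
    · obtain ⟨l, -, hl⟩ := exists_tendsto_of_mem_compact (U := U) (g := fun h => u h x t)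
        (K := Icc 0 (m * x)) isCompact_Icc (hpos.mono fun h hh =>
          ⟨hu.nonneg h hh x t hxt.1 hxt.2, hu.le_mul h hh x t hxt.1 hxt.2⟩)
      exact ⟨l, fun _ _ => hl⟩
    · exact ⟨0, fun h1 h2 => absurd ⟨h1, h2⟩ hxt⟩
  choose F hF using hex
  have hinit : ∀ x, 0 ≤ x → F x 0 = F₀ x := fun x hx =>
    tendsto_nhds_unique (hF x 0 hx le_rfl)
      (tendsto_const_nhds.congr' (hpos.mono fun h hh => (hu.initial h hh x hx).symm))
  have hlip : QuadrantLip C F := by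
    intro x t y s hx ht hy hs
    have h1 := ((hF x t hx ht).sub (hF y s hy hs)).abs
    have h2 := ((tendsto_id_of_le hU).const_add (|x - y| + |t - s|)).const_mul C
    rw [add_zero] at h2
    exact le_of_tendsto_of_tendsto h1 h2
      (hpos.mono fun h hh => hu.almost_lip h hh x t y s hx ht hy hs)
  refine ⟨F, hlip.lipschitzOnWith hC, fun t ht => ?_, fun x t hx ht => ⟨?_, ?_⟩, hinit,
    hu.isSubsolution hC hU hF, hu.isSupersolution hm₀ hm₁ hC hU hF⟩
  · have h1 : Tendsto (fun x : ℝ => C * t / x) atTop (𝓝 0) := tendsto_const_nhds.div_atTop tendsto_id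
    refine Tendsto.congr_dist (f₁ := fun x => F₀ x / x) hSub ?_
    refine squeeze_zero' (Eventually.of_forall fun _ => dist_nonneg) ?_ h1
    filter_upwards [eventually_gt_atTop 0] with x hx
    have h2 := hlip x 0 x t hx.le le_rfl hx.le ht
    rw [hinit x hx.le, sub_self, abs_zero, zero_add, zero_sub, abs_neg, abs_of_nonneg ht] at h2
    rw [Real.dist_eq, ← sub_div, abs_div, abs_of_pos hx]
    gcongr
  · exact ge_of_tendsto (hF x t hx ht) (hpos.mono fun h hh => hu.nonneg h hh x t hx ht)
  · exact le_of_tendsto (hF x t hx ht) (hpos.mono fun h hh => hu.le_mul h hh x t hx ht)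

end Stability

/-- One implicit step of size `h` of the dynamic programming equation. -/
noncomputable def hjStep (m h : ℝ) (f : ℝ → ℝ) (x : ℝ) : ℝ :=
  x / (x + h) * ⨅ y : Ici (0 : ℝ), (f y + h * cost m ((x - y) / h))

section Scheme

variable {m h : ℝ} {f g : ℝ → ℝ}

lemma cost_nonneg (hm₀ : 0 ≤ m) (hm₁ : m ≤ 1) (v : ℝ) : 0 ≤ cost m v :=
  (by positivity : 0 ≤ 1 / 2 * (v + 1 / 2 + m) ^ 2).trans (half_sq_le_cost hm₀ hm₁ v)

lemma bddBelow_hjStep (hm₀ : 0 ≤ m) (hm₁ : m ≤ 1) (hh : 0 < h) (hf : ∀ x, 0 ≤ x → 0 ≤ f x)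
    (x : ℝ) : BddBelow (range fun y : Ici (0 : ℝ) => f y + h * cost m ((x - y) / h)) := by
  refine ⟨0, ?_⟩
  rintro _ ⟨y, rfl⟩
  exact add_nonneg (hf y y.2) (mul_nonneg hh.le (cost_nonneg hm₀ hm₁ _))

lemma hjStep_mul (hh : 0 < h) {x : ℝ} (hx : 0 < x) :
    hjStep m h f x * (1 + h / x) = ⨅ y : Ici (0 : ℝ), (f y + h * cost m ((x - y) / h)) := by
  unfold hjStep
  field_simp

lemma hjStep_zero : hjStep m h f 0 = 0 := by simp [hjStep]

lemma hjStep_nonneg (hm₀ : 0 ≤ m) (hm₁ : m ≤ 1) (hh : 0 < h) (hf : ∀ x, 0 ≤ x → 0 ≤ f x)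
    {x : ℝ} (hx : 0 ≤ x) : 0 ≤ hjStep m h f x :=
  mul_nonneg (by positivity) (Real.iInf_nonneg fun y =>
    add_nonneg (hf y y.2) (mul_nonneg hh.le (cost_nonneg hm₀ hm₁ _)))

lemma hjStep_mul_le (hm₀ : 0 ≤ m) (hm₁ : m ≤ 1) (hh : 0 < h) (hf : ∀ x, 0 ≤ x → 0 ≤ f x)
    {x y : ℝ} (hx : 0 < x) (hy : 0 ≤ y) :
    hjStep m h f x * (1 + h / x) ≤ f y + h * cost m ((x - y) / h) := by
  rw [hjStep_mul hh hx]
  exact ciInf_le (bddBelow_hjStep hm₀ hm₁ hh hf x) (⟨y, hy⟩ : Ici (0 : ℝ))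

lemma hjStep_le (hm₀ : 0 ≤ m) (hm₁ : m ≤ 1) (hh : 0 < h) (hf : ∀ x, 0 ≤ x → 0 ≤ f x)
    {x y : ℝ} (hx : 0 < x) (hy : 0 ≤ y) :
    hjStep m h f x ≤ f y + h * cost m ((x - y) / h) :=
  (le_mul_of_one_le_right (hjStep_nonneg hm₀ hm₁ hh hf hx.le)
    (le_add_of_nonneg_right (by positivity))).trans (hjStep_mul_le hm₀ hm₁ hh hf hx hy)

lemma exists_lt_hjStep (hh : 0 < h) {x η : ℝ} (hx : 0 < x) (hη : 0 < η) :
    ∃ y, 0 ≤ y ∧ f y + h * cost m ((x - y) / h) < hjStep m h f x * (1 + h / x) + η := by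
  rw [hjStep_mul hh hx]
  obtain ⟨y, hy⟩ := exists_lt_of_ciInf_lt (lt_add_of_pos_right
    (⨅ y : Ici (0 : ℝ), (f y + h * cost m ((x - y) / h))) hη)
  exact ⟨y, y.2, hy⟩

lemma hjStep_le_mul (hm₀ : 0 ≤ m) (hm₁ : m ≤ 1) (hh : 0 < h) (hf : ∀ x, 0 ≤ x → 0 ≤ f x)
    (hf' : ∀ x, 0 ≤ x → f x ≤ m * x) {x : ℝ} (hx : 0 ≤ x) : hjStep m h f x ≤ m * x := by
  rcases hx.eq_or_lt with rfl | hx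
  · simp [hjStep_zero]
  have h1 := hjStep_mul_le hm₀ hm₁ hh hf hx (y := x + h / 2) (by positivity)
  have h2 := hf' (x + h / 2) (by positivity)
  have h3 : (x - (x + h / 2)) / h = -(1 / 2) := by field_simp; ring
  have h4 : cost m (-(1 / 2)) = m / 2 := by unfold cost; ring
  rw [h3, h4] at h1
  have h5 : hjStep m h f x * (1 + h / x) ≤ m * x * (1 + h / x) := by
    have : m * x * (1 + h / x) = m * x + m * h := by field_simp
    linarith
  exact le_of_mul_le_mul_right h5 (by positivity)

/-- The scheme is monotone and contracts constants. -/
lemma hjStep_le_add (hm₀ : 0 ≤ m) (hm₁ : m ≤ 1) (hh : 0 < h) (hf : ∀ x, 0 ≤ x → 0 ≤ f x)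
    {c : ℝ} (hc : 0 ≤ c) (hfg : ∀ x, 0 ≤ x → f x ≤ g x + c) {x : ℝ} (hx : 0 ≤ x) :
    hjStep m h f x ≤ hjStep m h g x + c := by
  rcases hx.eq_or_lt with rfl | hx
  · simpa [hjStep_zero] using hc
  have h1 : hjStep m h f x * (1 + h / x) ≤ hjStep m h g x * (1 + h / x) + c := by
    refine le_of_forall_pos_le_add fun η hη => ?_
    obtain ⟨y, hy, hlt⟩ := exists_lt_hjStep (m := m) (f := g) hh hx hη
    have h2 := hjStep_mul_le hm₀ hm₁ hh hf hx hy
    have h3 := hfg y hy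
    linarith
  have h4 : 0 ≤ c * (h / x) := by positivity
  refine le_of_mul_le_mul_right (a := 1 + h / x) ?_ (by positivity)
  linarith

lemma mul_abs_le_cost_add (hm₀ : 0 ≤ m) (hm₁ : m ≤ 1) {K : ℝ} (hK : 0 ≤ K) (v : ℝ) :
    K * |v| ≤ cost m v + (K ^ 2 / 2 + K * (1 / 2 + m)) := by
  have h1 := half_sq_le_cost hm₀ hm₁ v
  have h2 : |v| ≤ |v + 1 / 2 + m| + (1 / 2 + m) := by
    have := abs_sub (v + 1 / 2 + m) (1 / 2 + m)
    rwa [abs_of_nonneg (by positivity : 0 ≤ 1 / 2 + m),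
      show v + 1 / 2 + m - (1 / 2 + m) = v by ring] at this
  rw [← sq_abs] at h1
  have h3 := mul_le_mul_of_nonneg_left h2 hK
  nlinarith [sq_nonneg (|v + 1 / 2 + m| - K)]

lemma abs_hjStep_sub_le (hm₀ : 0 ≤ m) (hm₁ : m ≤ 1) (hh : 0 < h) (hf : ∀ x, 0 ≤ x → 0 ≤ f x)
    (hf' : ∀ x, 0 ≤ x → f x ≤ m * x) {K : ℝ} (hK : 0 ≤ K)
    (hL : ∀ x y, 0 ≤ x → 0 ≤ y → |f x - f y| ≤ K * |x - y|) {x : ℝ} (hx : 0 ≤ x) :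
    |hjStep m h f x - f x| ≤ (K ^ 2 / 2 + K * (1 / 2 + m) + m + 1) * h := by
  rcases hx.eq_or_lt with rfl | hx
  · have h1 := hf 0 le_rfl
    have h2 := hf' 0 le_rfl
    rw [mul_zero] at h2
    rw [hjStep_zero, le_antisymm h2 h1, sub_zero, abs_zero]
    positivity
  have hc : 0 ≤ K ^ 2 / 2 + K * (1 / 2 + m) := by positivity
  rw [abs_le]
  constructor
  · have h1 : f x - (K ^ 2 / 2 + K * (1 / 2 + m)) * h ≤ hjStep m h f x * (1 + h / x) := by
      rw [hjStep_mul hh hx]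
      refine le_ciInf fun y => ?_
      have h2 := (abs_le.1 (hL x y hx.le y.2)).2
      have h3 := mul_abs_le_cost_add hm₀ hm₁ hK ((x - y) / h)
      rw [abs_div, abs_of_pos hh, ← mul_div_assoc, div_le_iff₀ hh] at h3
      linarith
    have h2 : hjStep m h f x * (h / x) ≤ m * x * (h / x) :=
      mul_le_mul_of_nonneg_right (hjStep_le_mul hm₀ hm₁ hh hf hf' hx.le) (by positivity)
    have h3 : m * x * (h / x) = m * h := by field_simp
    linarith
  · have h1 := hjStep_le hm₀ hm₁ hh hf hx hx.le
    have h2 : cost m ((x - x) / h) ≤ m + 1 := by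
      unfold cost
      rw [sub_self, zero_div]
      linarith
    have h3 := mul_le_mul_of_nonneg_left h2 hh.le
    have h4 := mul_nonneg hc hh.le
    linarith

/-- Chaining a modulus at scale `h`. -/
lemma sub_le_of_local {E : ℝ} (hE : 0 ≤ E) (hh : 0 < h)
    (hloc : ∀ x y, 0 ≤ x → 0 ≤ y → |x - y| ≤ h → f x - f y ≤ E * h) {x y : ℝ}
    (hx : 0 ≤ x) (hy : 0 ≤ y) : f x - f y ≤ E * (|x - y| + h) := by
  have key : ∀ n : ℕ, ∀ x y, 0 ≤ x → 0 ≤ y → |x - y| ≤ n * h → f x - f y ≤ n * (E * h) := by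
    intro n
    induction n with
    | zero =>
      intro x y _ _ h1
      rw [Nat.cast_zero, zero_mul] at h1
      rw [sub_eq_zero.1 (abs_nonpos_iff.1 h1)]
      simp
    | succ n ih =>
      intro x y hx hy h1
      push_cast at h1 ⊢
      have hn : (0 : ℝ) < n + 1 := by positivity
      have e1 : x - (n / (n + 1) * y + 1 / (n + 1) * x) = n / (n + 1) * (x - y) := by
        field_simp; ring
      have e2 : (n / (n + 1) * y + 1 / (n + 1) * x) - y = 1 / (n + 1) * (x - y) := by
        field_simp; ring
      have b1 := ih x (n / (n + 1) * y + 1 / (n + 1) * x) hx (by positivity) (by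
        rw [e1, abs_mul, abs_of_nonneg (by positivity), div_mul_eq_mul_div, div_le_iff₀ hn]
        have := mul_le_mul_of_nonneg_left h1 (Nat.cast_nonneg (α := ℝ) n)
        linarith)
      have b2 := hloc (n / (n + 1) * y + 1 / (n + 1) * x) y (by positivity) hy (by
        rw [e2, abs_mul, abs_of_nonneg (by positivity), div_mul_eq_mul_div, div_le_iff₀ hn]
        linarith)
      linarith
  have h1 := key ⌈|x - y| / h⌉₊ x y hx hy (by
    rw [← div_le_iff₀ hh]
    exact Nat.le_ceil _)
  have h2 : (⌈|x - y| / h⌉₊ : ℝ) * h ≤ |x - y| + h := by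
    have h3 := (Nat.ceil_lt_add_one (by positivity : 0 ≤ |x - y| / h)).le
    have h4 := mul_le_mul_of_nonneg_right h3 hh.le
    rwa [add_mul, div_mul_cancel₀ _ hh.ne', one_mul] at h4
  have h5 := mul_le_mul_of_nonneg_left h2 hE
  linarith

lemma abs_natFloor_sub_le {a b : ℝ} (ha : 0 ≤ a) (hb : 0 ≤ b) :
    |(⌊a⌋₊ : ℝ) - ⌊b⌋₊| ≤ |a - b| + 1 := by
  have h1 := Nat.floor_le ha
  have h2 := Nat.floor_le hb
  have h3 := Nat.lt_floor_add_one a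
  have h4 := Nat.lt_floor_add_one b
  have h5 := le_abs_self (a - b)
  have h6 := neg_le_abs (a - b)
  rw [abs_le]
  constructor <;> linarith

/-- The iterates of the scheme, indexed by continuous time. -/
noncomputable def hjIterate (m : ℝ) (F₀ : ℝ → ℝ) (h x t : ℝ) : ℝ :=
  (hjStep m h)^[⌊t / h⌋₊] F₀ x

variable {F₀ : ℝ → ℝ}

lemma iterate_hjStep_bounds (hm₀ : 0 ≤ m) (hm₁ : m ≤ 1) (hh : 0 < h)
    (hBd : ∀ x : ℝ, 0 ≤ x → 0 ≤ F₀ x ∧ F₀ x ≤ m * x) (n : ℕ) :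
    ∀ x, 0 ≤ x → 0 ≤ (hjStep m h)^[n] F₀ x ∧ (hjStep m h)^[n] F₀ x ≤ m * x := by
  induction n with
  | zero => exact hBd
  | succ n ih =>
    intro x hx
    rw [Function.iterate_succ_apply']
    exact ⟨hjStep_nonneg hm₀ hm₁ hh (fun y hy => (ih y hy).1) hx,
      hjStep_le_mul hm₀ hm₁ hh (fun y hy => (ih y hy).1) (fun y hy => (ih y hy).2) hx⟩

lemma abs_iterate_succ_sub_le (hm₀ : 0 ≤ m) (hm₁ : m ≤ 1) (hh : 0 < h)
    (hBd : ∀ x : ℝ, 0 ≤ x → 0 ≤ F₀ x ∧ F₀ x ≤ m * x) {c : ℝ}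
    (hstep : ∀ x, 0 ≤ x → |hjStep m h F₀ x - F₀ x| ≤ c) (n : ℕ) :
    ∀ x, 0 ≤ x → |(hjStep m h)^[n + 1] F₀ x - (hjStep m h)^[n] F₀ x| ≤ c := by
  have hc : 0 ≤ c := (abs_nonneg _).trans (hstep 0 le_rfl)
  induction n with
  | zero => exact hstep
  | succ n ih =>
    intro x hx
    have hb := iterate_hjStep_bounds hm₀ hm₁ hh hBd
    have h1 := hjStep_le_add hm₀ hm₁ hh (fun y hy => (hb (n + 1) y hy).1) hc
      (fun y hy => sub_le_iff_le_add'.1 (abs_le.1 (ih y hy)).2) hx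
    have h2 := hjStep_le_add hm₀ hm₁ hh (fun y hy => (hb n y hy).1) hc
      (g := (hjStep m h)^[n + 1] F₀) (fun y hy => by linarith [(abs_le.1 (ih y hy)).1]) hx
    have e1 := congrFun (Function.iterate_succ_apply' (hjStep m h) (n + 1) F₀) x
    have e0 := congrFun (Function.iterate_succ_apply' (hjStep m h) n F₀) x
    rw [abs_le]
    constructor <;> linarith

lemma abs_iterate_sub_le {c : ℝ} {S : ℕ → ℝ → ℝ}
    (hS : ∀ n x, 0 ≤ x → |S (n + 1) x - S n x| ≤ c) (n k : ℕ) {x : ℝ} (hx : 0 ≤ x) :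
    |S n x - S k x| ≤ c * |(n : ℝ) - k| := by
  have key : ∀ k j : ℕ, |S (k + j) x - S k x| ≤ c * j := by
    intro k j
    induction j with
    | zero => simp
    | succ j ih =>
      have h1 := abs_sub_le (S (k + (j + 1)) x) (S (k + j) x) (S k x)
      have h2 := hS (k + j) x hx
      rw [← add_assoc] at h1 ⊢
      push_cast
      linarith
  rcases le_total k n with hkn | hkn
  · obtain ⟨j, rfl⟩ := Nat.exists_eq_add_of_le hkn
    simpa using key k j
  · obtain ⟨j, rfl⟩ := Nat.exists_eq_add_of_le hkn
    rw [abs_sub_comm, abs_sub_comm (n : ℝ)]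
    simpa using key n j

lemma iterate_sub_le_local (hm₀ : 0 ≤ m) (hm₁ : m ≤ 1) (hh : 0 < h)
    (hf : ∀ x, 0 ≤ x → 0 ≤ f x) (hf' : ∀ x, 0 ≤ x → f x ≤ m * x) {D : ℝ} (hD : 0 ≤ D)
    (hstep : ∀ x, 0 ≤ x → |hjStep m h f x - f x| ≤ D * h) {x y : ℝ} (hx : 0 ≤ x) (hy : 0 ≤ y)
    (hxy : |x - y| ≤ h) : f x - f y ≤ (D + 2 * m + 2) * h := by
  rcases hx.eq_or_lt with rfl | hx
  · have h1 := hf y hy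
    have h2 := hf' 0 le_rfl
    have h3 : 0 ≤ (D + 2 * m + 2) * h := by positivity
    linarith
  have h1 := (abs_le.1 (hstep x hx.le)).1
  have h2 := hjStep_le hm₀ hm₁ hh hf hx hy
  have h3 : |(x - y) / h| ≤ 1 := by rwa [abs_div, abs_of_pos hh, div_le_one hh]
  have h4 : cost m ((x - y) / h) ≤ 2 * m + 2 := by
    obtain ⟨h5, h6⟩ := abs_le.1 h3
    unfold cost
    nlinarith
  have h5 := mul_le_mul_of_nonneg_left h4 hh.le
  linarith

theorem exists_discreteHJ (hm₀ : 0 ≤ m) (hm₁ : m ≤ 1)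
    (hLip : ∃ K : NNReal, LipschitzOnWith K F₀ (Ici 0))
    (hBd : ∀ x : ℝ, 0 ≤ x → 0 ≤ F₀ x ∧ F₀ x ≤ m * x) :
    ∃ C, 0 ≤ C ∧ DiscreteHJ m C F₀ (hjIterate m F₀) := by
  obtain ⟨K, hK⟩ := hLip
  have hL : ∀ x y, 0 ≤ x → 0 ≤ y → |F₀ x - F₀ y| ≤ K * |x - y| := fun x y hx hy => by
    simpa [Real.dist_eq] using hK.dist_le_mul x hx y hy
  set D : ℝ := (K : ℝ) ^ 2 / 2 + K * (1 / 2 + m) + m + 1 with hD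
  have hD0 : 0 ≤ D := by positivity
  have hb := fun h (hh : 0 < h) => iterate_hjStep_bounds hm₀ hm₁ hh hBd
  have hsucc := fun h (hh : 0 < h) => abs_iterate_succ_sub_le hm₀ hm₁ hh hBd fun x hx =>
    abs_hjStep_sub_le hm₀ hm₁ hh (fun x hx => (hBd x hx).1) (fun x hx => (hBd x hx).2) K.2 hL hx
  have hfloor : ∀ h t : ℝ, 0 < h → h ≤ t → ⌊t / h⌋₊ = ⌊(t - h) / h⌋₊ + 1 := by
    intro h t hh ht
    rw [sub_div, div_self hh.ne', Nat.floor_sub_one, Nat.sub_add_cancel]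
    rw [Nat.one_le_floor_iff]
    rwa [one_le_div hh]
  refine ⟨D + (D + 2 * m + 2), by positivity, ?_, ?_, ?_, ?_, ?_, ?_⟩
  · exact fun h hh x t hx _ => (hb h hh _ x hx).1
  · exact fun h hh x t hx _ => (hb h hh _ x hx).2
  · intro h hh x hx
    simp [hjIterate]
  · intro h hh x t y s hx ht hy hs
    have hloc : ∀ n, ∀ x y : ℝ, 0 ≤ x → 0 ≤ y →
        (hjStep m h)^[n] F₀ x - (hjStep m h)^[n] F₀ y ≤ (D + 2 * m + 2) * (|x - y| + h) := by
      intro n x y hx hy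
      refine sub_le_of_local (by positivity) hh (fun x y hx hy hxy => ?_) hx hy
      refine iterate_sub_le_local hm₀ hm₁ hh (fun x hx => (hb h hh n x hx).1)
        (fun x hx => (hb h hh n x hx).2) hD0 (fun x hx => ?_) hx hy hxy
      rw [← Function.iterate_succ_apply' (hjStep m h) n F₀]
      exact hsucc h hh n x hx
    have h1 : |hjIterate m F₀ h x t - hjIterate m F₀ h y t| ≤
        (D + 2 * m + 2) * (|x - y| + h) := by
      rw [abs_le']
      refine ⟨hloc _ x y hx hy, ?_⟩
      rw [neg_sub, abs_sub_comm]
      exact hloc _ y x hy hx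
    have h2 : |hjIterate m F₀ h y t - hjIterate m F₀ h y s| ≤ D * (|t - s| + h) := by
      refine (abs_iterate_sub_le (S := fun n => (hjStep m h)^[n] F₀) (hsucc h hh) _ _ hy).trans ?_
      have h3 := abs_natFloor_sub_le (a := t / h) (b := s / h) (by positivity) (by positivity)
      rw [← sub_div, abs_div, abs_of_pos hh] at h3
      have h4 := mul_le_mul_of_nonneg_left h3 hh.le
      rw [mul_add, mul_div_cancel₀ _ hh.ne', mul_one] at h4
      rw [mul_assoc]
      exact mul_le_mul_of_nonneg_left h4 hD0
    have h3 := abs_sub_le (hjIterate m F₀ h x t) (hjIterate m F₀ h y t) (hjIterate m F₀ h y s)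
    have h4 : 0 ≤ D * |x - y| := by positivity
    have h5 : 0 ≤ (D + 2 * m + 2) * |t - s| := by positivity
    linarith
  · intro h hh x t y hx ht hy
    unfold hjIterate
    rw [hfloor h t hh ht, Function.iterate_succ_apply']
    exact hjStep_mul_le hm₀ hm₁ hh (fun x hx => (hb h hh _ x hx).1) hx hy
  · intro h hh x t η hx ht hη
    unfold hjIterate
    rw [hfloor h t hh ht, Function.iterate_succ_apply']
    exact exists_lt_hjStep hh hx hη

end Scheme

lemma GoodSolution.le {m : ℝ} (hm : 0 < m) {F₀ : ℝ → ℝ} {F G : ℝ → ℝ → ℝ}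
    (hF : GoodSolution m F₀ F) (hG : GoodSolution m F₀ G) {x t : ℝ} (hx : 0 ≤ x) (ht : 0 ≤ t) :
    F x t ≤ G x t := by
  obtain ⟨hFl, hFs, hFb, hFi, hFsol⟩ := hF
  obtain ⟨hGl, -, hGb, hGi, hGsol⟩ := hG
  obtain ⟨K, hK, hFK⟩ := exists_quadrantLip hFl
  obtain ⟨L, -, hGL⟩ := exists_quadrantLip hGl
  exact comparison_HJ hm (hK.trans (le_max_left K L)) (hFK.mono (le_max_left K L))
    (hGL.mono (le_max_right K L)) (hFs 0 le_rfl) (fun x t hx ht => (hFb x t hx ht).2) hGb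
    (fun x hx => by rw [hFi x hx, hGi x hx]) hFsol.1 hGsol.2 hx ht

/-- Theorem 1.1, wellposedness.
For `0 < m ≤ 1` and `F₀` Lipschitz, sublinear with `0 ≤ F₀(x) ≤ m·x`, there is exactly one
Lipschitz, sublinear-in-`x` function `F` with `0 ≤ F(x,t) ≤ m·x`, `F(x,0) = F₀(x)`,
solving (HJ) in the viscosity sense on `(0,∞)×(0,∞)`. -/
theorem wellposedness_HJ (m : ℝ) (hm₀ : 0 < m) (hm₁ : m ≤ 1)
    (F₀ : ℝ → ℝ)
    (hLip : ∃ K : NNReal, LipschitzOnWith K F₀ (Ici 0))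
    (hSub : Sublinear F₀)
    (hBd : ∀ x : ℝ, 0 ≤ x → 0 ≤ F₀ x ∧ F₀ x ≤ m * x) :
    ∃ F : ℝ → ℝ → ℝ, GoodSolution m F₀ F ∧
      ∀ G : ℝ → ℝ → ℝ, GoodSolution m F₀ G →
        ∀ x t : ℝ, 0 ≤ x → 0 ≤ t → G x t = F x t := by
  obtain ⟨C, hC, hu⟩ := exists_discreteHJ hm₀.le hm₁ hLip hBd
  obtain ⟨F, hF⟩ := hu.exists_goodSolution hm₀.le hm₁ hC hSub
  exact ⟨F, hF, fun G hG x t hx ht => le_antisymm (hG.le hm₀ hF hx ht) (hF.le hm₀ hG hx ht)⟩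
end

section
/- Let 0 < m ≤ 1. Let u, v:[0,∞)×[0,∞)→ℝ be continuous functions, each sublinear in x, satisfying 0 ≤ u(x,t) ≤ m·x, 0 ≤ v(x,t) ≤ m·x for all x,t ≥ 0, and u(x,0) ≤ v(x,0) for all x ≥ 0. If u is a viscosity subsolution and v is a viscosity supersolution of (HJ) on (0,∞)×(0,∞), then u(x,t) ≤ v(x,t) for all (x,t) ∈ [0,∞)×[0,∞). -/
open Set Filter

/-- The squared Euclidean distance on `ℝ × ℝ`. -/
def sqDist (a b : ℝ × ℝ) : ℝ := (a.1 - b.1) ^ 2 + (a.2 - b.2) ^ 2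

/-- A smooth strict subsolution of (HJ) on `(0,∞) × [0,S)`, tending to `-∞` superlinearly in `x`
and as `t → S`. -/
noncomputable def barrier (S : ℝ) (p : ℝ × ℝ) : ℝ := -(p.1 ^ 2 / 4 + S ^ 2) / (S - p.2)

/-- Doubling of variables with quadratic penalization on a compact set. -/
theorem exists_doubling_sequence {K : Set (ℝ × ℝ)} (hK : IsCompact K) {U V : ℝ × ℝ → ℝ}
    (hU : ContinuousOn U K) (hV : ContinuousOn V K) {z₀ : ℝ × ℝ} (hz₀ : z₀ ∈ K)
    (h₀ : V z₀ < U z₀) :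
    ∃ (z : ℝ × ℝ) (a b : ℕ → ℝ × ℝ) (c : ℕ → ℝ), z ∈ K ∧ V z < U z ∧
      (∀ n, a n ∈ K) ∧ (∀ n, b n ∈ K) ∧
      Tendsto a atTop (nhds z) ∧ Tendsto b atTop (nhds z) ∧
      (∀ n, ∀ p ∈ K, U p - c n * sqDist p (b n) ≤ U (a n) - c n * sqDist (a n) (b n)) ∧
      (∀ n, ∀ p ∈ K, V (b n) + c n * sqDist (a n) (b n) ≤ V p + c n * sqDist (a n) p) := by
  have hsq : Continuous fun q : (ℝ × ℝ) × (ℝ × ℝ) => sqDist q.1 q.2 := by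
    unfold sqDist; fun_prop
  have hUV : ContinuousOn (fun q : (ℝ × ℝ) × (ℝ × ℝ) => U q.1 - V q.2) (K ×ˢ K) :=
    (hU.comp continuousOn_fst fun q hq => hq.1).sub (hV.comp continuousOn_snd fun q hq => hq.2)
  have hKK : IsCompact (K ×ˢ K) := hK.prod hK
  have hne : (K ×ˢ K).Nonempty := ⟨(z₀, z₀), hz₀, hz₀⟩
  have hmax : ∀ n : ℕ, ∃ q ∈ K ×ˢ K, IsMaxOn
      (fun q : (ℝ × ℝ) × (ℝ × ℝ) => U q.1 - V q.2 - n * sqDist q.1 q.2) (K ×ˢ K) q := fun n =>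
    hKK.exists_isMaxOn hne (hUV.sub (continuousOn_const.mul hsq.continuousOn))
  choose q hqK hq using hmax
  obtain ⟨B, hB⟩ := hKK.bddAbove_image hUV
  obtain ⟨z, hzK, σ, hσ, hlim⟩ := hKK.tendsto_subseq hqK
  have hlim1 : Tendsto (fun n => (q (σ n)).1) atTop (nhds z.1) :=
    (continuous_fst.tendsto z).comp hlim
  have hlim2 : Tendsto (fun n => (q (σ n)).2) atTop (nhds z.2) :=
    (continuous_snd.tendsto z).comp hlim
  have hlow : ∀ n, U z₀ - V z₀ ≤ U (q n).1 - V (q n).2 - n * sqDist (q n).1 (q n).2 := by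
    intro n
    have := hq n (show (z₀, z₀) ∈ K ×ˢ K from ⟨hz₀, hz₀⟩)
    simpa [sqDist] using this
  have hnn : ∀ p r, 0 ≤ sqDist p r := fun p r => by unfold sqDist; positivity
  have hd : Tendsto (fun n => sqDist (q (σ n)).1 (q (σ n)).2) atTop (nhds 0) := by
    have hB' : Tendsto (fun n : ℕ => B / (σ n : ℝ)) atTop (nhds 0) :=
      (tendsto_const_div_atTop_nhds_zero_nat B).comp hσ.tendsto_atTop
    refine tendsto_of_tendsto_of_tendsto_of_le_of_le' tendsto_const_nhds hB'
      (Eventually.of_forall fun n => hnn _ _) ?_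
    filter_upwards [eventually_gt_atTop 0] with n hn
    have hpos : (0 : ℝ) < σ n := by exact_mod_cast hn.trans_le (hσ.id_le n)
    rw [le_div_iff₀ hpos]
    have h1 := hlow (σ n)
    have h2 : U (q (σ n)).1 - V (q (σ n)).2 ≤ B := hB ⟨q (σ n), hqK _, rfl⟩
    linarith
  have hz0 : sqDist z.1 z.2 = 0 :=
    tendsto_nhds_unique ((hsq.tendsto z).comp hlim) hd
  have hz : z.1 = z.2 := by
    unfold sqDist at hz0
    have h1 : (z.1.1 - z.2.1) ^ 2 = 0 := by
      nlinarith [sq_nonneg (z.1.1 - z.2.1), sq_nonneg (z.1.2 - z.2.2)]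
    have h2 : (z.1.2 - z.2.2) ^ 2 = 0 := by
      nlinarith [sq_nonneg (z.1.1 - z.2.1), sq_nonneg (z.1.2 - z.2.2)]
    exact Prod.ext (sub_eq_zero.1 (pow_eq_zero_iff two_ne_zero |>.1 h1))
      (sub_eq_zero.1 (pow_eq_zero_iff two_ne_zero |>.1 h2))
  have hlimUV : Tendsto (fun n => U (q (σ n)).1 - V (q (σ n)).2) atTop
      (nhds (U z.1 - V z.2)) :=
    (hUV z hzK).tendsto.comp
      (tendsto_nhdsWithin_iff.2 ⟨hlim, Eventually.of_forall fun n => hqK _⟩)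
  have hge : U z₀ - V z₀ ≤ U z.1 - V z.2 := by
    refine ge_of_tendsto' hlimUV fun n => ?_
    have h1 := hlow (σ n)
    have h2 := mul_nonneg (Nat.cast_nonneg (α := ℝ) (σ n)) (hnn (q (σ n)).1 (q (σ n)).2)
    linarith
  refine ⟨z.1, fun n => (q (σ n)).1, fun n => (q (σ n)).2, fun n => σ n, hzK.1, ?_,
    fun n => (hqK _).1, fun n => (hqK _).2, hlim1, hz ▸ hlim2, fun n p hp => ?_, fun n p hp => ?_⟩
  · rw [← hz] at hge
    linarith
  · have : U p - V (q (σ n)).2 - σ n * sqDist p (q (σ n)).2 ≤ _ :=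
      hq (σ n) (show (p, (q (σ n)).2) ∈ K ×ˢ K from ⟨hp, (hqK _).2⟩)
    simp only at this
    linarith
  · have : U (q (σ n)).1 - V p - σ n * sqDist (q (σ n)).1 p ≤ _ :=
      hq (σ n) (show ((q (σ n)).1, p) ∈ K ×ˢ K from ⟨(hqK _).1, hp⟩)
    simp only at this
    linarith

theorem inv_le_quadratic {τ τ₀ : ℝ} (hτ₀ : 0 < τ₀) (h : τ₀ / 2 ≤ τ) :
    1 / τ ≤ 1 / τ₀ + (τ₀ - τ) / τ₀ ^ 2 + 2 * (τ₀ - τ) ^ 2 / τ₀ ^ 3 := by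
  have hτ : 0 < τ := by linarith
  have : 1 / τ₀ + (τ₀ - τ) / τ₀ ^ 2 + 2 * (τ₀ - τ) ^ 2 / τ₀ ^ 3 - 1 / τ
      = (τ₀ - τ) ^ 2 * (2 * τ - τ₀) / (τ * τ₀ ^ 3) := by
    field_simp
    ring
  have h2 : 0 ≤ (τ₀ - τ) ^ 2 * (2 * τ - τ₀) / (τ * τ₀ ^ 3) :=
    div_nonneg (mul_nonneg (sq_nonneg _) (by linarith)) (by positivity)
  linarith

theorem barrier_strict_subsolution {m S x t : ℝ} (hm₀ : 0 < m) (hm₁ : m ≤ 1) (hx : 0 < x)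
    (ht : 0 ≤ t) (htS : t < S) :
    -(x ^ 2 / 4 + S ^ 2) / (S - t) ^ 2 +
      (1 / 2) * (-x / (2 * (S - t)) - m) * (-x / (2 * (S - t)) - m - 1) +
      barrier S (x, t) / x - m ≤ -1 / 2 := by
  have hτ : 0 < S - t := by linarith
  have h1 : 1 ≤ (S / (S - t)) ^ 2 := by
    have : 1 ≤ S / (S - t) := by rw [le_div_iff₀ hτ]; linarith
    nlinarith
  have h2 : 0 ≤ S ^ 2 / ((S - t) * x) := by positivity
  have key : -(x ^ 2 / 4 + S ^ 2) / (S - t) ^ 2 +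
      (1 / 2) * (-x / (2 * (S - t)) - m) * (-x / (2 * (S - t)) - m - 1) +
      barrier S (x, t) / x - m = -(x / (S - t)) ^ 2 / 8 + m * (x / (S - t)) / 2
        + m * (m - 1) / 2 - (S / (S - t)) ^ 2 - S ^ 2 / ((S - t) * x) := by
    simp only [barrier]
    field_simp
    ring
  rw [key]
  nlinarith [sq_nonneg (x / (S - t) - 2 * m)]

/-- A convex combination of a subsolution with the barrier is a strict subsolution, as seen by
quadratic test functions. -/
theorem IsSubsolutionHJ.strict_convex_combination {m S ε c : ℝ} {u : ℝ → ℝ → ℝ}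
    (hu : IsSubsolutionHJ m u) (hm₀ : 0 < m) (hm₁ : m ≤ 1) (hε₀ : 0 < ε) (hε₁ : ε < 1)
    {a b : ℝ × ℝ} (ha₁ : 0 < a.1) (ha₂ : 0 < a.2) (haS : a.2 < S)
    (hmax : ∀ᶠ p in nhds a,
      (1 - ε) * u p.1 p.2 + ε * barrier S p - c * sqDist p b ≤
        (1 - ε) * u a.1 a.2 + ε * barrier S a - c * sqDist a b) :
    2 * c * (a.2 - b.2) +
      (1 / 2) * (2 * c * (a.1 - b.1) - m) * (2 * c * (a.1 - b.1) - m - 1) +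
      ((1 - ε) * u a.1 a.2 + ε * barrier S a) / a.1 - m ≤ -ε / 2 := by
  obtain ⟨x, t⟩ := a
  obtain ⟨y, s⟩ := b
  simp only at ha₁ ha₂ haS hmax ⊢
  have hτ : 0 < S - t := by linarith
  have hε : 0 < 1 - ε := by linarith
  set τ := S - t with hτdef
  let φ : ℝ × ℝ → ℝ := fun p => (c * ((p.1 - y) ^ 2 + (p.2 - s) ^ 2) + ε * ((p.1 ^ 2 / 4 + S ^ 2) *
    (1 / τ + (p.2 - t) / τ ^ 2 + 2 * (p.2 - t) ^ 2 / τ ^ 3))) / (1 - ε)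
  have hφ : ContDiff ℝ 1 φ := by fun_prop
  have hloc : IsLocalMaxOn (fun p : ℝ × ℝ => u p.1 p.2 - φ p) (Ici 0 ×ˢ Ici 0) (x, t) := by
    refine Filter.Eventually.filter_mono nhdsWithin_le_nhds ?_
    have hev : ∀ᶠ p : ℝ × ℝ in nhds (x, t), p.2 < t + τ / 2 :=
      continuous_snd.continuousAt.eventually_lt continuousAt_const (by simpa using hτ)
    filter_upwards [hmax, hev] with p hp hpt
    have hq := inv_le_quadratic (τ := S - p.2) hτ (by linarith)
    have hk : τ - (S - p.2) = p.2 - t := by rw [hτdef]; ring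
    rw [hk] at hq
    have hb : -barrier S p ≤ (p.1 ^ 2 / 4 + S ^ 2) *
        (1 / τ + (p.2 - t) / τ ^ 2 + 2 * (p.2 - t) ^ 2 / τ ^ 3) := by
      have : -barrier S p = (p.1 ^ 2 / 4 + S ^ 2) * (1 / (S - p.2)) := by
        simp only [barrier]; ring
      rw [this]
      exact mul_le_mul_of_nonneg_left hq (by positivity)
    have hb' : -barrier S (x, t) = (x ^ 2 / 4 + S ^ 2) *
        (1 / τ + (t - t) / τ ^ 2 + 2 * (t - t) ^ 2 / τ ^ 3) := by
      simp only [barrier, ← hτdef]; ring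
    have hφp : (1 - ε) * φ p = c * sqDist p (y, s) + ε * ((p.1 ^ 2 / 4 + S ^ 2) *
        (1 / τ + (p.2 - t) / τ ^ 2 + 2 * (p.2 - t) ^ 2 / τ ^ 3)) := mul_div_cancel₀ _ hε.ne'
    have hφa : (1 - ε) * φ (x, t) = c * sqDist (x, t) (y, s) + ε * -barrier S (x, t) := by
      rw [hb']
      exact mul_div_cancel₀ _ hε.ne'
    have hεb := mul_le_mul_of_nonneg_left hb hε₀.le
    refine le_of_mul_le_mul_left ?_ hε
    simp only [mul_sub (1 - ε), hφp, hφa]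
    linarith
  have hdt : deriv (fun r => φ (x, r)) t =
      (2 * c * (t - s) + ε * ((x ^ 2 / 4 + S ^ 2) / τ ^ 2)) / (1 - ε) := by
    have h1 := (((hasDerivAt_id t).sub_const s).pow 2).const_add ((x - y) ^ 2)
    have h2 := (((hasDerivAt_id t).sub_const t).div_const (τ ^ 2)).const_add (1 / τ)
    have h3 := ((((hasDerivAt_id t).sub_const t).pow 2).const_mul 2).div_const (τ ^ 3)
    have h4 := ((h1.const_mul c).add
      (((h2.add h3).const_mul (x ^ 2 / 4 + S ^ 2)).const_mul ε)).div_const (1 - ε)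
    refine HasDerivAt.deriv (h4.congr_deriv ?_)
    simp
    ring
  have hdx : deriv (fun r => φ (r, t)) x =
      (2 * c * (x - y) + ε * (x / (2 * τ))) / (1 - ε) := by
    have h1 := (((hasDerivAt_id x).sub_const y).pow 2).add_const ((t - s) ^ 2)
    have h2 := ((((hasDerivAt_id x).pow 2).div_const 4).add_const (S ^ 2)).mul_const
      (1 / τ + (t - t) / τ ^ 2 + 2 * (t - t) ^ 2 / τ ^ 3)
    have h4 := ((h1.const_mul c).add (h2.const_mul ε)).div_const (1 - ε)
    refine HasDerivAt.deriv (h4.congr_deriv ?_)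
    simp
    ring_nf
  have hsub := hu φ hφ x t ha₁ ha₂ hloc
  have hbar := barrier_strict_subsolution hm₀ hm₁ ha₁ ha₂.le haS
  rw [hdt, hdx] at hsub
  rw [← hτdef] at hbar
  set P := (2 * c * (x - y) + ε * (x / (2 * τ))) / (1 - ε) with hP
  set Q := -x / (2 * τ) with hQ
  set q := (2 * c * (t - s) + ε * ((x ^ 2 / 4 + S ^ 2) / τ ^ 2)) / (1 - ε) with hq
  set g := -(x ^ 2 / 4 + S ^ 2) / τ ^ 2 with hg
  have hp : 2 * c * (x - y) = (1 - ε) * P + ε * Q := by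
    rw [hP, hQ, mul_div_cancel₀ _ hε.ne']; ring
  have hr : 2 * c * (t - s) = (1 - ε) * q + ε * g := by
    rw [hq, hg, mul_div_cancel₀ _ hε.ne']; ring
  rw [hp, hr, add_div, mul_div_assoc, mul_div_assoc]
  nlinarith [mul_le_mul_of_nonneg_left hsub hε.le, mul_le_mul_of_nonneg_left hbar hε₀.le,
    mul_nonneg (mul_nonneg hε.le hε₀.le) (sq_nonneg (P - Q))]

theorem IsSupersolutionHJ.quadratic_test {m c : ℝ} {v : ℝ → ℝ → ℝ}
    (hv : IsSupersolutionHJ m v) {a b : ℝ × ℝ} (hb₁ : 0 < b.1) (hb₂ : 0 < b.2)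
    (hmin : ∀ᶠ p in nhds b, v b.1 b.2 + c * sqDist a b ≤ v p.1 p.2 + c * sqDist a p) :
    0 ≤ 2 * c * (a.2 - b.2) +
      (1 / 2) * (2 * c * (a.1 - b.1) - m) * (2 * c * (a.1 - b.1) - m - 1) +
      v b.1 b.2 / b.1 - m := by
  obtain ⟨x, t⟩ := a
  obtain ⟨y, s⟩ := b
  simp only at hb₁ hb₂ hmin ⊢
  let φ : ℝ × ℝ → ℝ := fun p => -(c * ((x - p.1) ^ 2 + (t - p.2) ^ 2))
  have hφ : ContDiff ℝ 1 φ := by fun_prop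
  have hloc : IsLocalMinOn (fun p : ℝ × ℝ => v p.1 p.2 - φ p) (Ici 0 ×ˢ Ici 0) (y, s) := by
    refine Filter.Eventually.filter_mono nhdsWithin_le_nhds ?_
    filter_upwards [hmin] with p hp
    simpa [φ, sqDist] using hp
  have hdt : deriv (fun r => φ (y, r)) s = 2 * c * (t - s) := by
    have h := (((((hasDerivAt_id s).const_sub t).pow 2).const_add ((x - y) ^ 2)).const_mul c).neg
    refine HasDerivAt.deriv (h.congr_deriv ?_)
    simp
    ring
  have hdx : deriv (fun r => φ (r, s)) y = 2 * c * (x - y) := by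
    have h := (((((hasDerivAt_id y).const_sub x).pow 2).add_const ((t - s) ^ 2)).const_mul c).neg
    refine HasDerivAt.deriv (h.congr_deriv ?_)
    simp
    ring
  have h := hv φ hφ y s hb₁ hb₂ hloc
  rwa [hdt, hdx] at h

theorem barrier_nonpos {S : ℝ} {p : ℝ × ℝ} (h : p.2 < S) : barrier S p ≤ 0 :=
  div_nonpos_of_nonpos_of_nonneg (by nlinarith [sq_nonneg p.1, sq_nonneg S]) (by linarith)

/-- Outside a compact subset of `[0,∞) × [0,S)`, a small multiple of the barrier dominates `x`. -/
theorem exists_barrier_le {S ε : ℝ} (hS : 0 < S) (hε : 0 < ε) {x₀ t₀ : ℝ} (hx₀ : 0 ≤ x₀)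
    (ht₀ : t₀ < S) :
    ∃ R T, x₀ ≤ R ∧ t₀ ≤ T ∧ T < S ∧
      (∀ t, 0 ≤ t → t ≤ T → R + ε * barrier S (R, t) ≤ 0) ∧
      (∀ x, 0 ≤ x → x ≤ R → x + ε * barrier S (x, T) ≤ 0) := by
  have hR : 0 < 4 * S / ε + x₀ := by positivity
  set R := 4 * S / ε + x₀ with hRdef
  set δ := min (S - t₀) (ε * S ^ 2 / R) with hδdef
  have hδ : 0 < δ := lt_min (by linarith) (by positivity)
  have hδ₁ : δ ≤ S - t₀ := min_le_left _ _
  have hδ₂ : δ * R ≤ ε * S ^ 2 := (le_div_iff₀ hR).1 (min_le_right _ _)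
  have hRε : 4 * S ≤ ε * R := by
    have : ε * R = 4 * S + ε * x₀ := by rw [hRdef]; field_simp
    nlinarith
  refine ⟨R, S - δ, by rw [hRdef]; linarith [show 0 ≤ 4 * S / ε by positivity], by linarith,
    by linarith, fun t ht htT => ?_, fun x hx hxR => ?_⟩
  · have hτ : 0 < S - t := by linarith
    have : R ≤ ε * ((R ^ 2 / 4 + S ^ 2) / (S - t)) := by
      rw [← mul_div_assoc, le_div_iff₀ hτ]
      nlinarith [mul_le_mul_of_nonneg_left hRε hR.le, mul_nonneg hR.le ht,
        mul_nonneg hε.le (sq_nonneg S)]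
    simp only [barrier, neg_div]
    linarith
  · have : x ≤ ε * ((x ^ 2 / 4 + S ^ 2) / δ) := by
      rw [← mul_div_assoc, le_div_iff₀ hδ]
      nlinarith [mul_le_mul_of_nonneg_left hxR hδ.le, mul_nonneg hε.le (sq_nonneg x)]
    simp only [barrier, neg_div, sub_sub_cancel]
    linarith

/-- Comparison principle, Lemma 2.5.
For `0 < m ≤ 1`, if `u` is a continuous, sublinear-in-`x` viscosity subsolution and `v` a
continuous, sublinear-in-`x` viscosity supersolution of (HJ), both satisfying
`0 ≤ ·(x,t) ≤ m·x`, and `u(·,0) ≤ v(·,0)`, then `u ≤ v` on `[0,∞)×[0,∞)`. -/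
theorem comparison_principle_HJ (m : ℝ) (hm₀ : 0 < m) (hm₁ : m ≤ 1)
    (u v : ℝ → ℝ → ℝ)
    (hu_cont : ContinuousOn (fun p : ℝ × ℝ => u p.1 p.2) (Ici 0 ×ˢ Ici 0))
    (hv_cont : ContinuousOn (fun p : ℝ × ℝ => v p.1 p.2) (Ici 0 ×ˢ Ici 0))
    (hu_sub : SublinearInX u) (hv_sub : SublinearInX v)
    (hu_bd : ∀ x t : ℝ, 0 ≤ x → 0 ≤ t → 0 ≤ u x t ∧ u x t ≤ m * x)
    (hv_bd : ∀ x t : ℝ, 0 ≤ x → 0 ≤ t → 0 ≤ v x t ∧ v x t ≤ m * x)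
    (h_init : ∀ x : ℝ, 0 ≤ x → u x 0 ≤ v x 0)
    (hu_vis : IsSubsolutionHJ m u) (hv_vis : IsSupersolutionHJ m v) :
    ∀ x t : ℝ, 0 ≤ x → 0 ≤ t → u x t ≤ v x t := by
  intro x₀ t₀ hx₀ ht₀
  by_contra! hlt
  set S := t₀ + 1 with hS
  have hS₀ : 0 < S := by linarith
  have hw₀ : barrier S (x₀, t₀) ≤ 0 := barrier_nonpos (by simp [hS])
  have hv₀ := (hv_bd x₀ t₀ hx₀ ht₀).1
  obtain ⟨ε, hε₀, hε₁, hεlt⟩ : ∃ ε : ℝ, 0 < ε ∧ ε < 1 ∧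
      v x₀ t₀ < (1 - ε) * u x₀ t₀ + ε * barrier S (x₀, t₀) := by
    have hD : 0 < u x₀ t₀ - barrier S (x₀, t₀) := by linarith
    refine ⟨(u x₀ t₀ - v x₀ t₀) / (2 * (u x₀ t₀ - barrier S (x₀, t₀))),
      div_pos (by linarith) (by linarith), ?_, ?_⟩
    · rw [div_lt_one (by linarith)]; linarith
    · have : (u x₀ t₀ - v x₀ t₀) / (2 * (u x₀ t₀ - barrier S (x₀, t₀))) *
          (u x₀ t₀ - barrier S (x₀, t₀)) = (u x₀ t₀ - v x₀ t₀) / 2 := by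
        field_simp
      linarith
  obtain ⟨R, T, hR, hT, hTS, hRbar, hTbar⟩ :=
    exists_barrier_le (S := S) (ε := ε) hS₀ hε₀ hx₀ (by simp [hS] : t₀ < S)
  let U : ℝ × ℝ → ℝ := fun p => (1 - ε) * u p.1 p.2 + ε * barrier S p
  let V : ℝ × ℝ → ℝ := fun p => v p.1 p.2
  let K : Set (ℝ × ℝ) := Icc 0 R ×ˢ Icc 0 T
  have hKq : K ⊆ Ici 0 ×ˢ Ici 0 := prod_mono Icc_subset_Ici_self Icc_subset_Ici_self
  have hbarcont : ContinuousOn (barrier S) K := by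
    unfold barrier
    refine ContinuousOn.div (by fun_prop) (by fun_prop) fun p hp => ?_
    have := hp.2.2
    linarith
  have hUc : ContinuousOn U K :=
    (continuousOn_const.mul (hu_cont.mono hKq)).add (continuousOn_const.mul hbarcont)
  have hVc : ContinuousOn V K := hv_cont.mono hKq
  obtain ⟨z, a, b, c, hzK, hz, haK, hbK, ha, hb, hmax, hmin⟩ :=
    exists_doubling_sequence (isCompact_Icc.prod isCompact_Icc) hUc hVc
      (z₀ := (x₀, t₀)) ⟨⟨hx₀, hR⟩, ⟨ht₀, hT⟩⟩ hεlt
  obtain ⟨⟨hz₁, hzR⟩, hz₂, hzT⟩ := hzK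
  have hUle : ∀ p ∈ K, U p ≤ u p.1 p.2 := fun p hp => by
    have h1 := (hu_bd p.1 p.2 hp.1.1 hp.2.1).1
    have h2 := barrier_nonpos (S := S) (p := p) (hp.2.2.trans_lt hTS)
    simp only [U]
    nlinarith
  have hUle' : ∀ p ∈ K, U p ≤ p.1 + ε * barrier S p := fun p hp => by
    have h1 := hu_bd p.1 p.2 hp.1.1 hp.2.1
    have h2 : m * p.1 ≤ p.1 := mul_le_of_le_one_left hp.1.1 hm₁
    simp only [U]
    nlinarith
  have hzK : z ∈ K := ⟨⟨hz₁, hzR⟩, hz₂, hzT⟩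
  have hVz : 0 ≤ V z := (hv_bd z.1 z.2 hz₁ hz₂).1
  have hz₁' : 0 < z.1 := by
    refine lt_of_le_of_ne hz₁ fun h => ?_
    have h1 := hUle z hzK
    have h2 := (hu_bd z.1 z.2 hz₁ hz₂).2
    rw [← h, mul_zero] at h2
    rw [← h] at h1
    linarith
  have hz₂' : 0 < z.2 := by
    refine lt_of_le_of_ne hz₂ fun h => ?_
    have h1 := hUle z hzK
    have h2 : u z.1 z.2 ≤ V z := by
      simp only [V]
      rw [← h]
      exact h_init z.1 hz₁
    linarith
  have hzR' : z.1 < R := by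
    refine lt_of_le_of_ne hzR fun h => ?_
    have h1 := hUle' z hzK
    have h2 := hRbar z.2 hz₂ hzT
    rw [← h] at h2
    simp only [Prod.mk.eta] at h2
    linarith
  have hzT' : z.2 < T := by
    refine lt_of_le_of_ne hzT fun h => ?_
    have h1 := hUle' z hzK
    have h2 := hTbar z.1 hz₁ hzR
    rw [← h] at h2
    simp only [Prod.mk.eta] at h2
    linarith
  let O : Set (ℝ × ℝ) := Ioo 0 R ×ˢ Ioo 0 T
  have hO : IsOpen O := isOpen_Ioo.prod isOpen_Ioo
  have hOK : O ⊆ K := prod_mono Ioo_subset_Icc_self Ioo_subset_Icc_self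
  have hzO : O ∈ nhds z := hO.mem_nhds ⟨⟨hz₁', hzR'⟩, hz₂', hzT'⟩
  have hev : ∀ᶠ n in atTop, U (a n) / (a n).1 - V (b n) / (b n).1 ≤ -ε / 2 := by
    filter_upwards [ha hzO, hb hzO] with n han hbn
    have h1 := hu_vis.strict_convex_combination hm₀ hm₁ hε₀ hε₁ (S := S) (c := c n) (b := b n)
      han.1.1 han.2.1 (han.2.2.trans hTS)
      (mem_of_superset (hO.mem_nhds han) fun p hp => hmax n p (hOK hp))
    have h2 := hv_vis.quadratic_test (c := c n) (a := a n) hbn.1.1 hbn.2.1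
      (mem_of_superset (hO.mem_nhds hbn) fun p hp => hmin n p (hOK hp))
    simp only [U, V]
    linarith
  have hlim : Tendsto (fun n => U (a n) / (a n).1 - V (b n) / (b n).1) atTop
      (nhds (U z / z.1 - V z / z.1)) := by
    have hnhds : K ∈ nhds z := mem_of_superset hzO hOK
    exact ((((hUc.continuousAt hnhds).tendsto.comp ha).div
      ((continuous_fst.tendsto z).comp ha) hz₁'.ne')).sub
      (((hVc.continuousAt hnhds).tendsto.comp hb).div
      ((continuous_fst.tendsto z).comp hb) hz₁'.ne')
  have hle := le_of_tendsto hlim hev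
  rw [← sub_div] at hle
  have hpos : 0 < (U z - V z) / z.1 := div_pos (by linarith) hz₁'
  linarith
end
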